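/- In the stationary ergodic environment setting, assume the pair (a,V) satisfies the scaled hill condition (S), let β ≥ 0 and G ∈ 𝒢_sqc. Let θ₋(β) := 𝔼[∂_x u₋^β(0,·)] and θ₊(β) := 𝔼[∂_x u₊^β(0,·)], where u₊^β(·,ω) and u₋^β(·,ω) are the unique elements of 𝒮^β_+(ω) and 𝒮^β_−(ω) vanishing at 0 (given jointly measurable). Then for every θ with θ₋(β) < θ < θ₊(β) there is an event of probability 1 such that for every ω in it and every globally Lipschitz continuous function u_θ on [0,∞)×ℝ that is a viscosity solution of ∂_t w = a(x,ω)∂²_{xx}w + G(∂_x w) + βV(x,ω) on (0,∞)×ℝ with u_θ(0,x) = θx for all x, one has lim_{t→∞} u_θ(t,0)/t = β. -/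

import Mathlib

open Real Set MeasureTheory

noncomputable section

/-- The class 𝒢(α₀,α₁,γ): growth condition (G1) and local Lipschitz condition (G2). -/
def MemG (α₀ α₁ γ : ℝ) (G : ℝ → ℝ) : Prop :=
  (∀ p : ℝ, α₀ * |p| ^ γ - 1 / α₀ ≤ G p ∧ G p ≤ α₁ * (|p| ^ γ + 1)) ∧
  (∀ p q : ℝ, |G p - G q| ≤ α₁ * (|p| + |q| + 1) ^ (γ - 1) * |p - q|)

/-- The class 𝒢: union of the classes 𝒢(α₀,α₁,γ). -/
def MemGclass (G : ℝ → ℝ) : Prop :=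
  ∃ α₀ α₁ γ : ℝ, 0 < α₀ ∧ 0 < α₁ ∧ 1 < γ ∧ MemG α₀ α₁ γ G

/-- Condition (G4): strict monotonicity with rate η on both half-lines. -/
def StrictIncrRate (G : ℝ → ℝ) (η : ℝ) : Prop :=
  ∀ p₁ p₂ : ℝ, 0 ≤ p₁ → p₁ < p₂ →
    η * (p₂ - p₁) ≤ G p₂ - G p₁ ∧ η * (p₂ - p₁) ≤ G (-p₂) - G (-p₁)

/-- The class 𝒢_sqc: G ∈ 𝒢, G(0) = 0 and (G4) for some η > 0. -/
def MemGsqc (G : ℝ → ℝ) : Prop :=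
  MemGclass G ∧ G 0 = 0 ∧ ∃ η : ℝ, 0 < η ∧ StrictIncrRate G η

/-- G_+^{-1} : the inverse of the restriction of G to [0,∞). -/
def GplusInv (G : ℝ → ℝ) (y : ℝ) : ℝ := Function.invFunOn G (Set.Ici 0) y

/-- G_−^{-1} : the inverse of the restriction of G to (−∞,0]. -/
def GminusInv (G : ℝ → ℝ) (y : ℝ) : ℝ := Function.invFunOn G (Set.Iic 0) y

/-- Viscosity subsolution of a(x)u'' + G(u') + βV(x) = λ on ℝ. -/
def IsViscSubsol (a V G : ℝ → ℝ) (β lam : ℝ) (u : ℝ → ℝ) : Prop :=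
  ∀ x₀ : ℝ, ∀ φ : ℝ → ℝ, ContDiff ℝ 2 φ →
    IsLocalMax (fun x => u x - φ x) x₀ →
    lam ≤ a x₀ * deriv (deriv φ) x₀ + G (deriv φ x₀) + β * V x₀

/-- Viscosity supersolution of a(x)u'' + G(u') + βV(x) = λ on ℝ. -/
def IsViscSupersol (a V G : ℝ → ℝ) (β lam : ℝ) (u : ℝ → ℝ) : Prop :=
  ∀ x₀ : ℝ, ∀ φ : ℝ → ℝ, ContDiff ℝ 2 φ →
    IsLocalMin (fun x => u x - φ x) x₀ →
    a x₀ * deriv (deriv φ) x₀ + G (deriv φ x₀) + β * V x₀ ≤ lam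

/-- Continuous viscosity solution of a(x)u'' + G(u') + βV(x) = λ on ℝ. -/
def IsViscSol (a V G : ℝ → ℝ) (β lam : ℝ) (u : ℝ → ℝ) : Prop :=
  Continuous u ∧ IsViscSubsol a V G β lam u ∧ IsViscSupersol a V G β lam u

/-- The set 𝒮^λ_+ of Lipschitz viscosity solutions with
u'(x) ∈ [G_+^{-1}(λ−β), G_+^{-1}(λ)] for a.e. x ∈ ℝ. -/
def Splus (a V G : ℝ → ℝ) (β lam : ℝ) : Set (ℝ → ℝ) :=
  {u | (∃ K : NNReal, LipschitzWith K u) ∧ IsViscSol a V G β lam u ∧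
    ∀ᵐ x ∂(volume : Measure ℝ),
      deriv u x ∈ Set.Icc (GplusInv G (lam - β)) (GplusInv G lam)}

/-- The set 𝒮^λ_− of Lipschitz viscosity solutions with
u'(x) ∈ [G_−^{-1}(λ), G_−^{-1}(λ−β)] for a.e. x ∈ ℝ. -/
def Sminus (a V G : ℝ → ℝ) (β lam : ℝ) : Set (ℝ → ℝ) :=
  {u | (∃ K : NNReal, LipschitzWith K u) ∧ IsViscSol a V G β lam u ∧
    ∀ᵐ x ∂(volume : Measure ℝ),
      deriv u x ∈ Set.Icc (GminusInv G lam) (GminusInv G (lam - β))}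

/-- Viscosity solution, continuous on [0,∞)×ℝ, of
∂_t w = a(x) ∂²_xx w + G(∂_x w) + βV(x) on (0,∞)×ℝ. -/
def IsParabolicViscSol (a V G : ℝ → ℝ) (β : ℝ) (w : ℝ → ℝ → ℝ) : Prop :=
  ContinuousOn (fun p : ℝ × ℝ => w p.1 p.2) (Set.Ici 0 ×ˢ Set.univ) ∧
  (∀ t₀ x₀ : ℝ, 0 < t₀ → ∀ φ : ℝ × ℝ → ℝ, ContDiff ℝ 2 φ →
    IsLocalMax (fun p : ℝ × ℝ => w p.1 p.2 - φ p) (t₀, x₀) →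
    deriv (fun t => φ (t, x₀)) t₀ ≤
      a x₀ * deriv (deriv (fun x => φ (t₀, x))) x₀ +
        G (deriv (fun x => φ (t₀, x)) x₀) + β * V x₀) ∧
  (∀ t₀ x₀ : ℝ, 0 < t₀ → ∀ φ : ℝ × ℝ → ℝ, ContDiff ℝ 2 φ →
    IsLocalMin (fun p : ℝ × ℝ => w p.1 p.2 - φ p) (t₀, x₀) →
    a x₀ * deriv (deriv (fun x => φ (t₀, x))) x₀ +
      G (deriv (fun x => φ (t₀, x)) x₀) + β * V x₀ ≤
      deriv (fun t => φ (t, x₀)) t₀)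

/-- The primitive of a continuous function is differentiable. -/
lemma Continuous.hasDerivAt_primitive {f : ℝ → ℝ} (hf : Continuous f) (c x : ℝ) :
    HasDerivAt (fun z => ∫ y in c..z, f y) (f x) x :=
  intervalIntegral.integral_hasDerivAt_right (hf.intervalIntegrable _ _)
    (hf.stronglyMeasurableAtFilter _ _) hf.continuousAt

/-- A differentiable function bounded above has points at which it is at least any prescribed
value it takes and its derivative is arbitrarily small. -/
lemma exists_ge_abs_deriv_le {f f' : ℝ → ℝ} (hf : ∀ x, HasDerivAt f (f' x) x) {B : ℝ}
    (hB : ∀ x, f x ≤ B) {e : ℝ} (he : 0 < e) (x₀ : ℝ) : ∃ x, f x₀ ≤ f x ∧ |f' x| ≤ e := by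
  have hpos : ∀ x : ℝ, 0 < 1 + (x - x₀) ^ 2 := fun x => by positivity
  have hr : ∀ x, HasDerivAt (fun x => √(1 + (x - x₀) ^ 2))
      ((x - x₀) / √(1 + (x - x₀) ^ 2)) x := by
    intro x
    have h1 : HasDerivAt (fun x => 1 + (x - x₀) ^ 2) (2 * (x - x₀)) x := by
      have := (((hasDerivAt_id x).sub_const x₀).pow 2).const_add 1
      simpa using this
    have h2 := h1.sqrt (hpos x).ne'
    convert h2 using 1
    field_simp
  have hle : ∀ x : ℝ, |x - x₀| ≤ √(1 + (x - x₀) ^ 2) := fun x =>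
    Real.abs_le_sqrt (by linarith)
  have hd : ∀ x, HasDerivAt (fun x => f x - e * √(1 + (x - x₀) ^ 2))
      (f' x - e * ((x - x₀) / √(1 + (x - x₀) ^ 2))) x := fun x =>
    (hf x).sub ((hr x).const_mul e)
  have hcont : Continuous (fun x => f x - e * √(1 + (x - x₀) ^ 2)) :=
    continuous_iff_continuousAt.2 fun x => (hd x).continuousAt
  obtain ⟨x, hx⟩ := hcont.exists_forall_ge' (x₀ := x₀) (by
    rw [← Metric.cobounded_eq_cocompact]
    have : ∀ᶠ x in Bornology.cobounded ℝ, (B - f x₀ + e) / e + |x₀| ≤ ‖x‖ :=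
      tendsto_norm_cobounded_atTop.eventually_ge_atTop _
    filter_upwards [this] with x hx
    have h1 : |x| ≤ |x - x₀| + |x₀| := by
      have := abs_add_le (x - x₀) x₀
      simpa using this
    have h2 : (B - f x₀ + e) / e ≤ √(1 + (x - x₀) ^ 2) := by
      have := hle x
      rw [Real.norm_eq_abs] at hx
      linarith
    rw [div_le_iff₀ he] at h2
    have := hB x
    simp
    nlinarith)
  refine ⟨x, ?_, ?_⟩
  · have h1 := hx x₀
    have h2 : (1 : ℝ) ≤ √(1 + (x - x₀) ^ 2) := Real.one_le_sqrt.2 (by nlinarith [sq_nonneg (x - x₀)])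
    simp at h1
    nlinarith
  · have h1 : IsLocalMax (fun x => f x - e * √(1 + (x - x₀) ^ 2)) x :=
      Filter.Eventually.of_forall hx
    have h2 := h1.hasDerivAt_eq_zero (hd x)
    have h3 : f' x = e * ((x - x₀) / √(1 + (x - x₀) ^ 2)) := by linarith
    rw [h3, abs_mul, abs_of_pos he, abs_div, abs_of_nonneg (Real.sqrt_nonneg _)]
    have : |x - x₀| / √(1 + (x - x₀) ^ 2) ≤ 1 :=
      div_le_one_of_le₀ (hle x) (Real.sqrt_nonneg _)
    nlinarith

/-- The linear equation `A w' + L w = f` on the line has a bounded solution. -/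
lemma exists_bounded_linear_solution {A f : ℝ → ℝ} {ε L B : ℝ} (hA : Continuous A) (hε : 0 < ε)
    (hAε : ∀ x, ε ≤ A x) (hA1 : ∀ x, A x ≤ 1) (hL : 0 < L) (hf : Continuous f)
    (hB : ∀ x, |f x| ≤ B) :
    ∃ w : ℝ → ℝ, (∀ x, HasDerivAt w ((f x - L * w x) / A x) x) ∧ ∀ x, |w x| ≤ B / L := by
  have hA0 : ∀ x, 0 < A x := fun x => hε.trans_le (hAε x)
  have hB0 : 0 ≤ B := (abs_nonneg _).trans (hB 0)
  have hAi : Continuous (fun x => 1 / A x) := continuous_const.div hA fun x => (hA0 x).ne'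
  set S : ℝ → ℝ := fun x => ∫ y in (0 : ℝ)..x, 1 / A y with hS
  have hSd : ∀ x, HasDerivAt S (1 / A x) x := fun x => hAi.hasDerivAt_primitive 0 x
  have hS1 : ∀ x ≤ 0, S x ≤ x := by
    intro x hx
    have hm : AntitoneOn (fun z => z - S z) (Iic 0) := by
      apply antitoneOn_of_deriv_nonpos (convex_Iic 0)
      · exact fun z _ => ((hasDerivAt_id z).sub (hSd z)).continuousAt.continuousWithinAt
      · exact fun z _ => ((hasDerivAt_id z).sub (hSd z)).differentiableAt.differentiableWithinAt
      · intro z _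
        have hd : HasDerivAt (fun z => z - S z) (1 - 1 / A z) z := (hasDerivAt_id z).sub (hSd z)
        rw [hd.deriv]
        have : 1 ≤ 1 / A z := by rw [le_div_iff₀ (hA0 z)]; linarith [hA1 z]
        linarith
    have := hm (mem_Iic.2 hx) (mem_Iic.2 le_rfl) hx
    simp [hS] at this
    simpa [hS] using this
  set E : ℝ → ℝ := fun x => Real.exp (L * S x) with hE
  have hEd : ∀ x, HasDerivAt E (E x * (L * (1 / A x))) x := fun x => ((hSd x).const_mul L).exp
  have hEpos : ∀ x, 0 < E x := fun x => Real.exp_pos _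
  have hEc : Continuous E := continuous_iff_continuousAt.2 fun x => (hEd x).continuousAt
  have hElim : Filter.Tendsto E Filter.atBot (nhds 0) := by
    have h0 : Filter.Tendsto (fun x => Real.exp (L * x)) Filter.atBot (nhds 0) :=
      Real.tendsto_exp_atBot.comp (Filter.tendsto_id.const_mul_atBot hL)
    refine tendsto_of_tendsto_of_tendsto_of_le_of_le' tendsto_const_nhds h0
      (Filter.Eventually.of_forall fun x => (hEpos x).le) ?_
    filter_upwards [Filter.eventually_le_atBot 0] with x hx
    exact Real.exp_le_exp.2 (mul_le_mul_of_nonneg_left (hS1 x hx) hL.le)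
  have hEAc : Continuous (fun x => E x / A x) := hEc.div hA fun x => (hA0 x).ne'
  have hint0 : ∀ x, IntegrableOn (fun y => E y / A y) (Iic x) := by
    have hbase : IntegrableOn (fun y => E y / A y) (Iic 0) := by
      refine Integrable.mono' ((integrableOn_exp_mul_Iic hL 0).div_const ε)
        hEAc.aestronglyMeasurable ?_
      refine (ae_restrict_iff' measurableSet_Iic).2 (Filter.Eventually.of_forall fun y hy => ?_)
      rw [Real.norm_of_nonneg (div_nonneg (hEpos y).le (hA0 y).le)]
      exact div_le_div₀ (Real.exp_pos _).le
        (Real.exp_le_exp.2 (mul_le_mul_of_nonneg_left (hS1 y hy) hL.le)) hε (hAε y)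
    intro x
    have h2 : IntegrableOn (fun y => E y / A y) (Icc 0 x) := hEAc.continuousOn.integrableOn_Icc
    refine (hbase.union h2).mono_set fun y hy => ?_
    rcases le_total y 0 with h | h
    · exact Or.inl h
    · exact Or.inr ⟨h, hy⟩
  have hfc : Continuous (fun y => E y / A y * f y) := hEAc.mul hf
  have hbd : ∀ y, ‖E y / A y * f y‖ ≤ B * (E y / A y) := by
    intro y
    rw [norm_mul, Real.norm_of_nonneg (div_nonneg (hEpos y).le (hA0 y).le), Real.norm_eq_abs,
      mul_comm]
    exact mul_le_mul_of_nonneg_right (hB y) (div_nonneg (hEpos y).le (hA0 y).le)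
  have hint : ∀ x, IntegrableOn (fun y => E y / A y * f y) (Iic x) := fun x =>
    Integrable.mono' ((hint0 x).const_mul B) hfc.aestronglyMeasurable
      (Filter.Eventually.of_forall hbd)
  have hI : ∀ x, ∫ y in Iic x, E y / A y = E x / L := by
    intro x
    have := integral_Iic_of_hasDerivAt_of_tendsto' (f := fun y => E y / L)
      (f' := fun y => E y / A y) (a := x) (m := 0) (fun y _ => ((hEd y).div_const L).congr_deriv (by
        field_simp)) (hint0 x) (by simpa using hElim.div_const L)
    simpa using this
  set F : ℝ → ℝ := fun x => ∫ y in Iic x, E y / A y * f y with hF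
  have hFd : ∀ x, HasDerivAt F (E x / A x * f x) x := by
    intro x
    have h1 : F = fun z => F 0 + ∫ y in (0 : ℝ)..z, E y / A y * f y := by
      funext z
      rw [← intervalIntegral.integral_Iic_sub_Iic (hint 0) (hint z)]
      ring
    rw [h1]
    exact (hfc.hasDerivAt_primitive 0 x).const_add _
  refine ⟨fun x => F x / E x, fun x => ?_, fun x => ?_⟩
  · refine ((hFd x).div (hEd x) (hEpos x).ne').congr_deriv ?_
    have := (hEpos x).ne'
    have := (hA0 x).ne'
    field_simp
  · rw [abs_div, abs_of_pos (hEpos x), div_le_iff₀ (hEpos x)]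
    calc |F x| ≤ ∫ y in Iic x, B * (E y / A y) :=
          norm_integral_le_of_norm_le ((hint0 x).const_mul B) (Filter.Eventually.of_forall hbd)
      _ = B / L * E x := by rw [integral_const_mul, hI]; ring

/-- The equation `A p' + H p = g` on the line, with `H` bi-Lipschitz and increasing, has a bounded
solution. -/
lemma exists_bounded_solution {A g H : ℝ → ℝ} {ε η L B : ℝ} (hA : Continuous A) (hε : 0 < ε)
    (hAε : ∀ x, ε ≤ A x) (hA1 : ∀ x, A x ≤ 1) (hη : 0 < η)
    (hH : ∀ x y, x ≤ y → η * (y - x) ≤ H y - H x ∧ H y - H x ≤ L * (y - x))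
    (hHc : Continuous H) (hg : Continuous g) (hB : ∀ x, |g x| ≤ B) :
    ∃ p : ℝ → ℝ, (∀ x, HasDerivAt p ((g x - H (p x)) / A x) x) ∧ ∃ C, ∀ x, |p x| ≤ C := by
  have hA0 : ∀ x, 0 < A x := fun x => hε.trans_le (hAε x)
  have hηL : η ≤ L := by
    have := hH 0 1 zero_le_one
    linarith
  have hL : 0 < L := hη.trans_le hηL
  have hdiff : ∀ x y, |(L * x - H x) - (L * y - H y)| ≤ (L - η) * |x - y| := by
    have key : ∀ x y, x ≤ y → |(L * x - H x) - (L * y - H y)| ≤ (L - η) * |x - y| := by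
      intro x y hxy
      obtain ⟨h1, h2⟩ := hH x y hxy
      rw [abs_sub_comm x y, abs_of_nonneg (sub_nonneg.2 hxy), abs_le]
      constructor <;> nlinarith
    intro x y
    rcases le_total x y with h | h
    · exact key x y h
    · rw [abs_sub_comm, abs_sub_comm x y]
      exact key y x h
  have hsolve : ∀ p : BoundedContinuousFunction ℝ ℝ, ∃ w : BoundedContinuousFunction ℝ ℝ,
      ∀ x, HasDerivAt w ((g x + (L * p x - H (p x)) - L * w x) / A x) x := by
    intro p
    obtain ⟨w, hw, hwb⟩ := exists_bounded_linear_solution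
      (f := fun x => g x + (L * p x - H (p x))) (B := B + ((L - η) * ‖p‖ + |H 0|))
      hA hε hAε hA1 hL (by fun_prop) (by
        intro x
        have h1 := hdiff (p x) 0
        have h2 : |p x| ≤ ‖p‖ := p.norm_coe_le_norm x
        have h3 : |L * p x - H (p x)| ≤ |(L * p x - H (p x)) - (L * 0 - H 0)| + |H 0| := by
          have := abs_add_le ((L * p x - H (p x)) - (L * 0 - H 0)) (-H 0)
          rw [abs_neg] at this
          refine le_trans (le_of_eq ?_) this
          congr 1
          ring
        have h4 : (L - η) * |p x - 0| ≤ (L - η) * ‖p‖ := by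
          rw [sub_zero]
          exact mul_le_mul_of_nonneg_left h2 (by linarith)
        have := abs_add_le (g x) (L * p x - H (p x))
        linarith [hB x])
    exact ⟨BoundedContinuousFunction.ofNormedAddCommGroup w
      (continuous_iff_continuousAt.2 fun x => (hw x).continuousAt) _ hwb, hw⟩
  choose T hT using hsolve
  have hlip : ∀ p q, dist (T p) (T q) ≤ (1 - η / L) * dist p q := by
    have key : ∀ p q x, T p x - T q x ≤ (1 - η / L) * dist p q := by
      intro p q x₀
      refine le_of_forall_pos_le_add fun e he => ?_
      obtain ⟨x, hx, hxd⟩ := exists_ge_abs_deriv_le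
        (fun x => (hT p x).sub (hT q x)) (B := ‖T p - T q‖)
        (fun x => (le_abs_self _).trans ((T p - T q).norm_coe_le_norm x)) (mul_pos hL he) x₀
      simp only [Pi.sub_apply] at hx
      have h1 := hdiff (p x) (q x)
      have h2 : |p x - q x| ≤ dist p q := by
        rw [← Real.dist_eq]
        exact BoundedContinuousFunction.dist_coe_le_dist x
      have h3 : (L - η) * |p x - q x| ≤ (L - η) * dist p q :=
        mul_le_mul_of_nonneg_left h2 (by linarith)
      rw [← sub_div, abs_div, abs_of_pos (hA0 x), div_le_iff₀ (hA0 x)] at hxd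
      have h4 : L * e * A x ≤ L * e := by nlinarith [hA1 x, mul_pos hL he]
      have h5 := (abs_le.1 (hxd.trans h4)).1
      have h6 := (abs_le.1 (h1.trans h3)).2
      have h7 : L * (T p x - T q x) ≤ (L - η) * dist p q + L * e := by linarith
      have h8 : (1 - η / L) * dist p q + e = ((L - η) * dist p q + L * e) / L := by
        field_simp
      rw [h8, le_div_iff₀ hL]
      nlinarith
    intro p q
    have hk : 0 ≤ 1 - η / L := by
      rw [sub_nonneg, div_le_one hL]
      exact hηL
    refine (BoundedContinuousFunction.dist_le (mul_nonneg hk dist_nonneg)).2 fun x => ?_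
    rw [Real.dist_eq, abs_le]
    constructor
    · have := key q p x
      rw [dist_comm] at this
      linarith
    · exact key p q x
  have hk : 0 ≤ 1 - η / L := by
    rw [sub_nonneg, div_le_one hL]
    exact hηL
  have hc : ContractingWith (1 - η / L).toNNReal T := by
    refine ⟨Real.toNNReal_lt_one.2 ?_, LipschitzWith.of_dist_le_mul fun p q => ?_⟩
    · have := div_pos hη hL
      linarith
    · rw [Real.coe_toNNReal _ hk]
      exact hlip p q
  have hfix : T hc.fixedPoint = hc.fixedPoint := hc.fixedPoint_isFixedPt
  refine ⟨hc.fixedPoint, fun x => ?_, ‖hc.fixedPoint‖, fun x =>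
    hc.fixedPoint.norm_coe_le_norm x⟩
  have := hT hc.fixedPoint x
  rw [hfix] at this
  refine this.congr_deriv ?_
  congr 1
  ring

/-- A bounded solution of `A p' + H p = g` with `0 ≤ g ≤ H M` takes values in `[0, M]`. -/
lemma solution_mem_Icc {A g H p : ℝ → ℝ} {η M C : ℝ} (hA0 : ∀ x, 0 < A x)
    (hA1 : ∀ x, A x ≤ 1) (hη : 0 < η) (hH : ∀ x y, x ≤ y → η * (y - x) ≤ H y - H x)
    (hH0 : H 0 = 0) (hg0 : ∀ x, 0 ≤ g x) (hgM : ∀ x, g x ≤ H M)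
    (hp : ∀ x, HasDerivAt p ((g x - H (p x)) / A x) x) (hC : ∀ x, |p x| ≤ C) (x₀ : ℝ) :
    p x₀ ∈ Icc 0 M := by
  constructor
  · by_contra! hneg
    obtain ⟨x, hx, hxd⟩ := exists_ge_abs_deriv_le (fun x => (hp x).neg) (B := C)
      (fun x => (neg_le_abs _).trans (hC x)) (e := η * (-p x₀) / 2)
      (by have := mul_pos hη (neg_pos.2 hneg); linarith) x₀
    simp only [Pi.neg_apply] at hx
    rw [abs_neg, abs_div, abs_of_pos (hA0 x), div_le_iff₀ (hA0 x)] at hxd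
    have h1 := hH (p x) 0 (by linarith)
    have h2 := (abs_le.1 hxd).2
    have h3 : η * (-p x₀) / 2 * A x ≤ η * (-p x₀) / 2 := by
      have := mul_pos hη (neg_pos.2 hneg)
      nlinarith [hA1 x]
    have := hg0 x
    nlinarith
  · by_contra! hbig
    have hpos : 0 < η * (p x₀ - M) := mul_pos hη (sub_pos.2 hbig)
    obtain ⟨x, hx, hxd⟩ := exists_ge_abs_deriv_le hp (B := C)
      (fun x => (le_abs_self _).trans (hC x)) (half_pos hpos) x₀
    rw [abs_div, abs_of_pos (hA0 x), div_le_iff₀ (hA0 x)] at hxd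
    have h1 := hH M (p x) (by linarith)
    have h2 := (abs_le.1 hxd).1
    have h3 : η * (p x₀ - M) / 2 * A x ≤ η * (p x₀ - M) / 2 := by nlinarith [hA1 x]
    have := hgM x
    nlinarith

/-- A derivative bound for bounded solutions of `A p' + H p = g` that does not depend on the
ellipticity constant: an a priori bound `Λ` improves to `Λ / 2` plus a constant. -/
lemma solution_deriv_bound_improve {A g H p : ℝ → ℝ} {η κ K B C Λ : ℝ} (hA0 : ∀ x, 0 < A x)
    (hA1 : ∀ x, A x ≤ 1) (hκ : 0 < κ) (hAκ : ∀ x y, |√(A x) - √(A y)| ≤ κ * |x - y|)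
    (hη : 0 < η) (hH : ∀ x y, x ≤ y → η * (y - x) ≤ H y - H x)
    (hK : ∀ x y, |g x - g y| ≤ K * |x - y|) (hB : ∀ x, |g x - H (p x)| ≤ B)
    (hp : ∀ x, HasDerivAt p ((g x - H (p x)) / A x) x) (hC : ∀ x, |p x| ≤ C)
    (hΛ : ∀ x, |(g x - H (p x)) / A x| ≤ Λ) (x₀ : ℝ) :
    |(g x₀ - H (p x₀)) / A x₀| ≤ Λ / 2 + (K + 2 * κ * (B / (η / (4 * κ)) ^ 2)) / η := by
  set r := η / (4 * κ) with hr
  have hr0 : 0 < r := by positivity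
  have hrη : 2 * r * κ = η / 2 := by rw [hr]; field_simp; norm_num
  set D : ℝ → ℝ := fun x => (g x - H (p x)) / A x with hD
  have hAD : ∀ x, A x * D x = g x - H (p x) := fun x => by
    have := (hA0 x).ne'
    simp only [hD]
    field_simp
  have hB0 : 0 ≤ B := (abs_nonneg _).trans (hB 0)
  have hK0 : 0 ≤ K := by simpa using (abs_nonneg _).trans (hK 1 0)
  have hΛ0 : 0 ≤ Λ := (abs_nonneg _).trans (hΛ 0)
  have hbig : ∀ x, r ≤ √(A x) → |D x| ≤ B / r ^ 2 := by
    intro x hx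
    have h1 : r ^ 2 ≤ A x := by
      rw [← Real.sq_sqrt (hA0 x).le]
      exact pow_le_pow_left₀ hr0.le hx 2
    simp only [hD]
    rw [abs_div, abs_of_pos (hA0 x)]
    exact div_le_div₀ hB0 (hB x) (by positivity) h1
  have key : ∀ h z, p (z + h) - p z ≤
      (Λ / 2 + (K + 2 * κ * (B / r ^ 2)) / η) * |h| := by
    intro h z
    have hstep : ∀ e, 0 < e → η * (p (z + h) - p z) ≤
        (η * (Λ / 2) + (K + 2 * κ * (B / r ^ 2))) * |h| + 2 * e := by
      intro e he
      obtain ⟨x, hx, hxd⟩ := exists_ge_abs_deriv_le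
        (fun x => ((hp (x + h)).comp_add_const x h).sub (hp x)) (B := C + C)
        (fun x => by
          have h1 := (abs_le.1 (hC (x + h))).2
          have h2 := (abs_le.1 (hC x)).1
          simp only [Pi.sub_apply]
          linarith) he z
      simp only [Pi.sub_apply] at hx
      change |D (x + h) - D x| ≤ e at hxd
      by_cases hneg : p (x + h) - p x ≤ 0
      · have : η * (p (z + h) - p z) ≤ 0 :=
          mul_nonpos_of_nonneg_of_nonpos hη.le (hx.trans hneg)
        have : 0 ≤ (η * (Λ / 2) + (K + 2 * κ * (B / r ^ 2))) * |h| := by positivity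
        linarith
      push Not at hneg
      have h1 := hH (p x) (p (x + h)) (by linarith)
      have h2 := (abs_le.1 (hK (x + h) x)).2
      have hh : x + h - x = h := by ring
      rw [hh] at h2
      have hsq : |A (x + h) - A x| = |√(A (x + h)) - √(A x)| * (√(A (x + h)) + √(A x)) := by
        rw [← abs_of_nonneg (add_nonneg (Real.sqrt_nonneg (A (x + h))) (Real.sqrt_nonneg (A x))),
          ← abs_mul]
        congr 1
        have := Real.mul_self_sqrt (hA0 x).le
        have := Real.mul_self_sqrt (hA0 (x + h)).le
        nlinarith
      have hκh := hAκ (x + h) x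
      rw [hh] at hκh
      have hs0 := Real.sqrt_nonneg (A x)
      have hs1 := Real.sqrt_nonneg (A (x + h))
      have hs0' : √(A x) ≤ 1 := Real.sqrt_le_one.2 (hA1 x)
      have hs1' : √(A (x + h)) ≤ 1 := Real.sqrt_le_one.2 (hA1 (x + h))
      have hmain : |A (x + h) - A x| * |D x| ≤
          η * (Λ / 2) * |h| + 2 * κ * (B / r ^ 2) * |h| + e := by
        by_cases hsum : √(A (x + h)) + √(A x) ≤ 2 * r
        · have h3 : |A (x + h) - A x| ≤ η / 2 * |h| := by
            rw [hsq, ← hrη]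
            calc _ ≤ κ * |h| * (2 * r) := mul_le_mul hκh hsum (by positivity) (by positivity)
              _ = _ := by ring
          have h4 : |A (x + h) - A x| * |D x| ≤ η / 2 * |h| * Λ :=
            mul_le_mul h3 (hΛ x) (abs_nonneg _) (by positivity)
          have : 0 ≤ 2 * κ * (B / r ^ 2) * |h| := by positivity
          linarith
        · push Not at hsum
          have h3 : |A (x + h) - A x| ≤ 2 * κ * |h| := by
            rw [hsq]
            calc _ ≤ κ * |h| * 2 := mul_le_mul hκh (by linarith) (by positivity) (by positivity)
              _ = _ := by ring
          have h5 : |A (x + h) - A x| ≤ 1 := by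
            rw [abs_le]
            constructor <;> linarith [hA1 x, hA1 (x + h), hA0 x, hA0 (x + h)]
          have h4 : |D x| ≤ B / r ^ 2 + e := by
            by_cases hx0 : r ≤ √(A x)
            · linarith [hbig x hx0]
            · have := hbig (x + h) (by push Not at hx0; linarith)
              have h6 := abs_sub_abs_le_abs_sub (D x) (D (x + h))
              rw [abs_sub_comm] at h6
              linarith
          have h7 : 0 ≤ B / r ^ 2 := by positivity
          calc |A (x + h) - A x| * |D x| ≤ |A (x + h) - A x| * (B / r ^ 2 + e) :=
                mul_le_mul_of_nonneg_left h4 (abs_nonneg _)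
            _ = |A (x + h) - A x| * (B / r ^ 2) + |A (x + h) - A x| * e := by ring
            _ ≤ 2 * κ * |h| * (B / r ^ 2) + 1 * e :=
                add_le_add (mul_le_mul_of_nonneg_right h3 h7) (mul_le_mul_of_nonneg_right h5 he.le)
            _ ≤ _ := by
              have : 0 ≤ η * (Λ / 2) * |h| := by positivity
              linarith
      have h8 : H (p (x + h)) - H (p x) = (g (x + h) - g x)
          - (A (x + h) * (D (x + h) - D x) + (A (x + h) - A x) * D x) := by
        have := hAD x
        have := hAD (x + h)
        linarith
      have h9 : -e ≤ A (x + h) * (D (x + h) - D x) := by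
        have h10 : |A (x + h) * (D (x + h) - D x)| ≤ 1 * e := by
          rw [abs_mul, abs_of_pos (hA0 _)]
          exact mul_le_mul (hA1 _) hxd (abs_nonneg _) zero_le_one
        have := (abs_le.1 h10).1
        linarith
      have h11 : -(|A (x + h) - A x| * |D x|) ≤ (A (x + h) - A x) * D x := by
        rw [← abs_mul]
        exact neg_abs_le _
      have h12 : η * (p (z + h) - p z) ≤ η * (p (x + h) - p x) :=
        mul_le_mul_of_nonneg_left hx hη.le
      nlinarith
    have hlim : η * (p (z + h) - p z) ≤
        (η * (Λ / 2) + (K + 2 * κ * (B / r ^ 2))) * |h| :=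
      le_of_forall_pos_le_add fun e he => by
        have := hstep (e / 2) (half_pos he)
        linarith
    have : (Λ / 2 + (K + 2 * κ * (B / r ^ 2)) / η) * |h| =
        ((η * (Λ / 2) + (K + 2 * κ * (B / r ^ 2))) * |h|) / η := by
      field_simp
    rw [this, le_div_iff₀ hη]
    linarith
  have hnn : 0 ≤ Λ / 2 + (K + 2 * κ * (B / r ^ 2)) / η := by positivity
  rw [← Real.norm_eq_abs]
  refine (hp x₀).le_of_lip' hnn (Filter.Eventually.of_forall fun x => ?_)
  rw [Real.norm_eq_abs, Real.norm_eq_abs, abs_le]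
  constructor
  · have := key (x₀ - x) x
    rw [show x + (x₀ - x) = x₀ by ring, abs_sub_comm] at this
    linarith
  · have := key (x - x₀) x₀
    rwa [show x₀ + (x - x₀) = x by ring] at this

/-- The derivative of a bounded solution of `A p' + H p = g` is bounded independently of the
ellipticity constant. -/
lemma solution_deriv_bound {A g H p : ℝ → ℝ} {ε η κ K B C : ℝ} (hε : 0 < ε)
    (hAε : ∀ x, ε ≤ A x)
    (hA1 : ∀ x, A x ≤ 1) (hκ : 0 < κ) (hAκ : ∀ x y, |√(A x) - √(A y)| ≤ κ * |x - y|)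
    (hη : 0 < η) (hH : ∀ x y, x ≤ y → η * (y - x) ≤ H y - H x)
    (hK : ∀ x y, |g x - g y| ≤ K * |x - y|) (hB : ∀ x, |g x - H (p x)| ≤ B)
    (hp : ∀ x, HasDerivAt p ((g x - H (p x)) / A x) x) (hC : ∀ x, |p x| ≤ C) (x₀ : ℝ) :
    |(g x₀ - H (p x₀)) / A x₀| ≤ 2 * ((K + 2 * κ * (B / (η / (4 * κ)) ^ 2)) / η) := by
  have hA0 : ∀ x, 0 < A x := fun x => hε.trans_le (hAε x)
  have hbdd : BddAbove (range fun x => |(g x - H (p x)) / A x|) := by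
    refine ⟨B / ε, ?_⟩
    rintro _ ⟨x, rfl⟩
    simp only
    rw [abs_div, abs_of_pos (hA0 x)]
    exact div_le_div₀ ((abs_nonneg _).trans (hB x)) (hB x) hε (hAε x)
  have h1 : ∀ x, |(g x - H (p x)) / A x| ≤ ⨆ x, |(g x - H (p x)) / A x| := le_ciSup hbdd
  have h2 : (⨆ x, |(g x - H (p x)) / A x|) ≤ _ :=
    ciSup_le (solution_deriv_bound_improve hA0 hA1 hκ hAκ hη hH hK hB hp hC h1)
  linarith [h1 x₀]

/-- `p` is a profile for `a p' + G p = g` with values in `I`: a uniform limit of `C¹` functions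
with values in `I` that solve the equation up to uniformly small errors. -/
def IsProfile (a g G : ℝ → ℝ) (I : Set ℝ) (p : ℝ → ℝ) : Prop :=
  (∀ x, p x ∈ I) ∧ ∀ δ : ℝ, 0 < δ → ∃ q q' : ℝ → ℝ, (∀ x, HasDerivAt q (q' x) x) ∧
    Continuous q' ∧ ∀ x, q x ∈ I ∧ |q x - p x| ≤ δ ∧ |a x * q' x + G (q x) - g x| ≤ δ

lemma IsProfile.continuous {a g G p : ℝ → ℝ} {I : Set ℝ} (hp : IsProfile a g G I p) :
    Continuous p := by
  have h : ∀ n : ℕ, ∃ q : ℝ → ℝ, Continuous q ∧ ∀ x, |q x - p x| ≤ 1 / ((n : ℝ) + 1) := by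
    intro n
    obtain ⟨q, q', hq, -, h⟩ := hp.2 (1 / ((n : ℝ) + 1)) (by positivity)
    exact ⟨q, continuous_iff_continuousAt.2 fun x => (hq x).continuousAt, fun x => (h x).2.1⟩
  choose q hqc hq using h
  have : TendstoUniformly q p Filter.atTop := by
    rw [Metric.tendstoUniformly_iff]
    intro e he
    have hlim := (tendsto_one_div_add_atTop_nhds_zero_nat (𝕜 := ℝ)).eventually_lt_const he
    filter_upwards [hlim] with n hn x
    rw [dist_comm, Real.dist_eq]
    exact (hq n x).trans_lt hn
  exact this.continuous (Filter.Frequently.of_forall hqc)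

lemma IsProfile.comp_add_const {a g G p : ℝ → ℝ} {I : Set ℝ} (hp : IsProfile a g G I p) (y : ℝ) :
    IsProfile (fun x => a (x + y)) (fun x => g (x + y)) G I (fun x => p (x + y)) := by
  refine ⟨fun x => hp.1 _, fun δ hδ => ?_⟩
  obtain ⟨q, q', hq, hc, h⟩ := hp.2 δ hδ
  exact ⟨fun x => q (x + y), fun x => q' (x + y), fun x => (hq (x + y)).comp_add_const x y,
    by fun_prop, fun x => h (x + y)⟩

lemma IsProfile.reflect {a g G p : ℝ → ℝ} {I J : Set ℝ}
    (hp : IsProfile (fun x => a (-x)) (fun x => g (-x)) (fun s => G (-s)) I p)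
    (hIJ : ∀ s ∈ I, -s ∈ J) : IsProfile a g G J (fun x => -p (-x)) := by
  refine ⟨fun x => hIJ _ (hp.1 _), fun δ hδ => ?_⟩
  obtain ⟨q, q', hq, hc, h⟩ := hp.2 δ hδ
  refine ⟨fun x => -q (-x), fun x => q' (-x), fun x => ?_, by fun_prop, fun x => ?_⟩
  · have := ((hq (-x)).scomp x (hasDerivAt_neg x)).neg
    exact this.congr_deriv (by simp)
  · obtain ⟨h1, h2, h3⟩ := h (-x)
    refine ⟨hIJ _ h1, ?_, by simpa using h3⟩
    rw [← abs_neg]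
    refine le_trans (le_of_eq ?_) h2
    congr 1
    ring

/-- Existence of a profile with values in `[0, M]`. -/
lemma exists_profile {a g G : ℝ → ℝ} {η L M κ K : ℝ} (ha0 : ∀ x, 0 ≤ a x) (ha1 : ∀ x, a x ≤ 1)
    (hκ : 0 < κ) (haκ : ∀ x y, |√(a x) - √(a y)| ≤ κ * |x - y|)
    (hη : 0 < η) (hL : 0 ≤ L) (hM : 0 ≤ M) (hGc : Continuous G) (hG0 : G 0 = 0)
    (hG : ∀ x y, 0 ≤ x → x ≤ y → y ≤ M → η * (y - x) ≤ G y - G x ∧ G y - G x ≤ L * (y - x))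
    (hK : ∀ x y, |g x - g y| ≤ K * |x - y|) (hg0 : ∀ x, 0 ≤ g x) (hgM : ∀ x, g x ≤ G M) :
    ∃ p, IsProfile a g G (Icc 0 M) p := by
  set c : ℝ → ℝ := fun s => max 0 (min s M) with hc
  set H : ℝ → ℝ := fun s => G (c s) + η * (s - c s) with hHdef
  have hc_mem : ∀ s, c s ∈ Icc 0 M := fun s => ⟨le_max_left _ _, max_le hM (min_le_right _ _)⟩
  have hc_of : ∀ s ∈ Icc 0 M, c s = s := fun s hs => by
    simp only [hc]
    rw [min_eq_left hs.2, max_eq_right hs.1]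
  have hH_of : ∀ s ∈ Icc 0 M, H s = G s := fun s hs => by simp [hHdef, hc_of s hs]
  have hcc : Continuous c := by fun_prop
  have hHc : Continuous H := by fun_prop
  have hc_mono : ∀ x y, x ≤ y → 0 ≤ c y - c x ∧ c y - c x ≤ y - x := by
    intro x y hxy
    have h1 : c x ≤ c y := max_le_max le_rfl (min_le_min hxy le_rfl)
    refine ⟨by linarith, ?_⟩
    simp only [hc]
    rcases le_total x M with h | h <;> rcases le_total y M with h' | h' <;>
      rcases le_total 0 x with h0 | h0 <;> rcases le_total 0 y with h0' | h0' <;>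
      simp [*] <;> linarith
  have hH : ∀ x y, x ≤ y → η * (y - x) ≤ H y - H x ∧ H y - H x ≤ (L + η) * (y - x) := by
    intro x y hxy
    obtain ⟨h1, h2⟩ := hc_mono x y hxy
    obtain ⟨h3, h4⟩ := hG (c x) (c y) (hc_mem x).1 (by linarith) (hc_mem y).2
    simp only [hHdef]
    constructor
    · nlinarith
    · nlinarith
  have hHM : H M = G M := hH_of M ⟨hM, le_rfl⟩
  have hH0 : H 0 = 0 := by rw [hH_of 0 ⟨le_rfl, hM⟩, hG0]
  have hgc : Continuous g := by
    have : LipschitzWith K.toNNReal g := LipschitzWith.of_dist_le_mul fun x y => by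
      rw [Real.dist_eq, Real.dist_eq]
      exact (hK x y).trans (mul_le_mul_of_nonneg_right (Real.le_coe_toNNReal K) (abs_nonneg _))
    exact this.continuous
  have hac : Continuous a := by
    have h1 : LipschitzWith κ.toNNReal (fun x => √(a x)) :=
      LipschitzWith.of_dist_le_mul fun x y => by
        rw [Real.dist_eq, Real.dist_eq, Real.coe_toNNReal _ hκ.le]
        exact haκ x y
    have h2 : a = fun x => √(a x) ^ 2 := by
      funext x
      rw [Real.sq_sqrt (ha0 x)]
    rw [h2]
    exact h1.continuous.pow 2
  set C := 2 * ((K + 2 * κ * (G M / (η / (4 * κ)) ^ 2)) / η) with hC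
  set ε : ℕ → ℝ := fun n => 1 / ((n : ℝ) + 1) with hεdef
  have hε0 : ∀ n, 0 < ε n := fun n => by simp only [hεdef]; positivity
  have hε1 : ∀ n, ε n ≤ 1 := fun n => by
    simp only [hεdef]
    rw [div_le_one (by positivity)]
    have : (0 : ℝ) ≤ n := Nat.cast_nonneg n
    linarith
  have hex : ∀ n, ∃ p : ℝ → ℝ, (∀ x, HasDerivAt p ((g x - H (p x)) / max (a x) (ε n)) x) ∧
      (∀ x, p x ∈ Icc 0 M) ∧ ∀ x, |(g x - H (p x)) / max (a x) (ε n)| ≤ C := by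
    intro n
    have hAε : ∀ x, ε n ≤ max (a x) (ε n) := fun x => le_max_right _ _
    have hA1 : ∀ x, max (a x) (ε n) ≤ 1 := fun x => max_le (ha1 x) (hε1 n)
    obtain ⟨p, hp, Cp, hCp⟩ := exists_bounded_solution (hac.max continuous_const) (hε0 n) hAε hA1
      hη hH hHc hgc (B := G M) (fun x => by
        rw [abs_of_nonneg (hg0 x)]
        exact hgM x)
    have hpm : ∀ x, p x ∈ Icc 0 M := solution_mem_Icc (fun x => (hε0 n).trans_le (hAε x)) hA1 hη
      (fun x y h => (hH x y h).1) hH0 hg0 (by rwa [hHM]) hp hCp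
    refine ⟨p, hp, hpm, solution_deriv_bound (hε0 n) hAε hA1 hκ ?_ hη
      (fun x y h => (hH x y h).1) hK ?_ hp hCp⟩
    · intro x y
      rw [Real.sqrt_monotone.map_max, Real.sqrt_monotone.map_max]
      exact (abs_max_sub_max_le_abs _ _ _).trans (haκ x y)
    · intro x
      have h1 := (hH 0 (p x) (hpm x).1).1
      have h2 := (hH (p x) M (hpm x).2).1
      have h3 : 0 ≤ η * (p x - 0) := mul_nonneg hη.le (by linarith [(hpm x).1])
      have h4 : 0 ≤ η * (M - p x) := mul_nonneg hη.le (by linarith [(hpm x).2])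
      rw [abs_le]
      constructor <;> linarith [hg0 x, hgM x]
  choose p hp hpm hpC using hex
  have hCnn : 0 ≤ C := (abs_nonneg _).trans (hpC 0 0)
  have hcmp : ∀ n m x₀, p n x₀ - p m x₀ ≤ C / η * (ε n + ε m) := by
    intro n m x₀
    have hstep : ∀ e, 0 < e → η * (p n x₀ - p m x₀) ≤ C * (ε n + ε m) + e := by
      intro e he
      obtain ⟨x, hx, hxd⟩ := exists_ge_abs_deriv_le (fun x => (hp n x).sub (hp m x)) (B := M)
        (fun x => by
          have := (hpm n x).2
          have := (hpm m x).1
          simp only [Pi.sub_apply]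
          linarith) he x₀
      simp only [Pi.sub_apply] at hx
      have hAn : 0 < max (a x) (ε n) := (hε0 n).trans_le (le_max_right _ _)
      have hAm : 0 < max (a x) (ε m) := (hε0 m).trans_le (le_max_right _ _)
      have h0 := hpC n x
      set Dn := (g x - H (p n x)) / max (a x) (ε n) with hDn
      set Dm := (g x - H (p m x)) / max (a x) (ε m) with hDm
      have h1 : max (a x) (ε n) * Dn = g x - H (p n x) := by
        rw [hDn]; field_simp
      have h2 : max (a x) (ε m) * Dm = g x - H (p m x) := by
        rw [hDm]; field_simp
      have h3 : |max (a x) (ε n) - max (a x) (ε m)| ≤ ε n + ε m := by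
        rw [max_comm (a x), max_comm (a x)]
        refine (abs_max_sub_max_le_abs _ _ _).trans ?_
        rw [abs_le]
        constructor <;> linarith [hε0 n, hε0 m]
      have h4 : |max (a x) (ε m) * (Dn - Dm)| ≤ 1 * e := by
        rw [abs_mul, abs_of_pos hAm]
        exact mul_le_mul (max_le (ha1 x) (hε1 m)) hxd (abs_nonneg _) zero_le_one
      have h5 : |(max (a x) (ε n) - max (a x) (ε m)) * Dn| ≤ (ε n + ε m) * C := by
        rw [abs_mul]
        exact mul_le_mul h3 h0 (abs_nonneg _) (by linarith [hε0 n, hε0 m])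
      have h6 := (abs_le.1 h4).1
      have h7 := (abs_le.1 h5).1
      have h8 : H (p n x) - H (p m x) ≤ C * (ε n + ε m) + e := by nlinarith
      rcases le_total (p n x) (p m x) with h | h
      · have h9 : η * (p n x₀ - p m x₀) ≤ 0 :=
          mul_nonpos_of_nonneg_of_nonpos hη.le (by linarith)
        have : 0 ≤ C * (ε n + ε m) := mul_nonneg hCnn (by linarith [hε0 n, hε0 m])
        linarith
      · have h9 := (hH _ _ h).1
        have h10 := mul_le_mul_of_nonneg_left hx hη.le
        linarith
    have h1 : η * (p n x₀ - p m x₀) ≤ C * (ε n + ε m) := le_of_forall_pos_le_add hstep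
    rw [div_mul_eq_mul_div, le_div_iff₀ hη]
    linarith
  have hcmp' : ∀ n m x, |p n x - p m x| ≤ C / η * (ε n + ε m) := by
    intro n m x
    rw [abs_le]
    constructor
    · have := hcmp m n x
      rw [add_comm] at this
      linarith
    · exact hcmp n m x
  have hεlim : Filter.Tendsto ε Filter.atTop (nhds 0) := tendsto_one_div_add_atTop_nhds_zero_nat
  have hlim : ∀ x, ∃ l, Filter.Tendsto (fun n => p n x) Filter.atTop (nhds l) := by
    intro x
    apply cauchySeq_tendsto_of_complete
    refine cauchySeq_of_le_tendsto_0 (fun n => C / η * (ε n + ε n)) ?_ ?_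
    · intro n m N hn hm
      rw [Real.dist_eq]
      refine (hcmp' n m x).trans (mul_le_mul_of_nonneg_left ?_ (by positivity))
      exact add_le_add (Nat.one_div_le_one_div hn) (Nat.one_div_le_one_div hm)
    · simpa using (hεlim.add hεlim).const_mul (C / η)
  choose P hP using hlim
  have hPn : ∀ n x, |p n x - P x| ≤ C / η * ε n := by
    intro n x
    have h1 : Filter.Tendsto (fun m => |p n x - p m x|) Filter.atTop (nhds |p n x - P x|) :=
      ((hP x).const_sub _).abs
    have h2 : Filter.Tendsto (fun m => C / η * (ε n + ε m)) Filter.atTop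
        (nhds (C / η * (ε n + 0))) := (hεlim.const_add _).const_mul _
    simpa using le_of_tendsto_of_tendsto' h1 h2 fun m => hcmp' n m x
  refine ⟨P, fun x => isClosed_Icc.mem_of_tendsto (hP x)
    (Filter.Eventually.of_forall fun n => hpm n x), fun δ hδ => ?_⟩
  have h1 : Filter.Tendsto (fun n => C / η * ε n) Filter.atTop (nhds 0) := by
    simpa using hεlim.const_mul (C / η)
  have h2 : Filter.Tendsto (fun n => ε n * C) Filter.atTop (nhds 0) := by
    simpa using hεlim.mul_const C
  obtain ⟨n, hn1, hn2⟩ := ((h1.eventually_le_const hδ).and (h2.eventually_le_const hδ)).exists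
  have hpc : Continuous (p n) := continuous_iff_continuousAt.2 fun x => (hp n x).continuousAt
  refine ⟨p n, fun x => (g x - H (p n x)) / max (a x) (ε n), hp n, ?_, fun x =>
    ⟨hpm n x, (hPn n x).trans hn1, ?_⟩⟩
  · exact (hgc.sub (hHc.comp hpc)).div (hac.max continuous_const)
      fun x => ((hε0 n).trans_le (le_max_right _ _)).ne'
  · have hA : 0 < max (a x) (ε n) := (hε0 n).trans_le (le_max_right _ _)
    have h0 := hpC n x
    rw [← hH_of _ (hpm n x)]
    simp only
    set D := (g x - H (p n x)) / max (a x) (ε n) with hD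
    have h3 : max (a x) (ε n) * D = g x - H (p n x) := by
      rw [hD]; field_simp
    have h4 : a x * D + H (p n x) - g x = (a x - max (a x) (ε n)) * D := by linarith
    rw [h4, abs_mul]
    refine le_trans (mul_le_mul ?_ h0 (abs_nonneg _) (hε0 n).le) hn2
    rw [abs_le]
    rcases le_total (a x) (ε n) with h | h
    · rw [max_eq_right h]
      constructor <;> linarith [ha0 x, hε0 n]
    · rw [max_eq_left h]
      constructor <;> linarith [hε0 n]

/-- Where the diffusion coefficient is zero, a profile solves the first-order equation. -/
lemma IsProfile.eq_of_eq_zero {a g G p : ℝ → ℝ} {I : Set ℝ} {L : ℝ} (hp : IsProfile a g G I p)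
    (hL0 : 0 ≤ L) (hL : ∀ x ∈ I, ∀ y ∈ I, |G x - G y| ≤ L * |x - y|) {x : ℝ} (hx : a x = 0) :
    G (p x) = g x := by
  have key : ∀ e, 0 < e → |G (p x) - g x| ≤ 0 + e := by
    intro e he
    obtain ⟨q, q', -, -, h⟩ := hp.2 (e / (L + 1)) (by positivity)
    obtain ⟨h1, h2, h3⟩ := h x
    rw [hx, zero_mul, zero_add] at h3
    have h4 := hL _ (hp.1 x) _ h1
    rw [abs_sub_comm (p x)] at h4
    have h5 := abs_sub_le (G (p x)) (G (q x)) (g x)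
    have h6 : L * |q x - p x| ≤ L * (e / (L + 1)) := mul_le_mul_of_nonneg_left h2 hL0
    have h7 : L * (e / (L + 1)) + e / (L + 1) = e := by field_simp
    linarith
  have := abs_nonpos_iff.1 (le_of_forall_pos_le_add key)
  linarith

/-- Where the diffusion coefficient is positive, a profile is differentiable and solves the
equation classically. -/
lemma IsProfile.hasDerivAt {a g G p : ℝ → ℝ} {I : Set ℝ} {L : ℝ} (hp : IsProfile a g G I p)
    (hac : Continuous a) (hL0 : 0 ≤ L) (hL : ∀ x ∈ I, ∀ y ∈ I, |G x - G y| ≤ L * |x - y|)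
    {x₀ : ℝ} (hx₀ : 0 < a x₀) : HasDerivAt p ((g x₀ - G (p x₀)) / a x₀) x₀ := by
  have h : ∀ n : ℕ, ∃ q q' : ℝ → ℝ, (∀ x, HasDerivAt q (q' x) x) ∧ ∀ x, q x ∈ I ∧
      |q x - p x| ≤ 1 / ((n : ℝ) + 1) ∧ |a x * q' x + G (q x) - g x| ≤ 1 / ((n : ℝ) + 1) := by
    intro n
    obtain ⟨q, q', hq, -, h⟩ := hp.2 (1 / ((n : ℝ) + 1)) (by positivity)
    exact ⟨q, q', hq, h⟩
  choose q q' hq hb using h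
  have hlim := tendsto_one_div_add_atTop_nhds_zero_nat (𝕜 := ℝ)
  refine hasDerivAt_of_tendstoUniformlyOn (f := q) (f' := q') (l := Filter.atTop)
    (g' := fun x => (g x - G (p x)) / a x)
    (isOpen_lt (continuous_const (y := a x₀ / 2)) hac) ?_
    (Filter.Eventually.of_forall fun n x _ => hq n x) ?_ (by simpa using half_lt_self hx₀)
  · rw [Metric.tendstoUniformlyOn_iff]
    intro e he
    have h1 : Filter.Tendsto (fun n : ℕ => (1 + L) * (1 / ((n : ℝ) + 1)) / (a x₀ / 2))
        Filter.atTop (nhds 0) := by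
      simpa using (hlim.const_mul (1 + L)).div_const (a x₀ / 2)
    filter_upwards [h1.eventually_lt_const he] with n hn x hx
    have hax : a x₀ / 2 < a x := hx
    have hax0 : 0 < a x := by linarith
    obtain ⟨h2, h3, h4⟩ := hb n x
    refine lt_of_le_of_lt ?_ hn
    have h5 : (g x - G (p x)) / a x - q' n x =
        (-(a x * q' n x + G (q n x) - g x) + (G (q n x) - G (p x))) / a x := by
      field_simp
      ring
    rw [Real.dist_eq, h5, abs_div, abs_of_pos hax0]
    have h6 := hL _ h2 _ (hp.1 x)
    have h7 : L * |q n x - p x| ≤ L * (1 / ((n : ℝ) + 1)) := mul_le_mul_of_nonneg_left h3 hL0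
    have h8 := abs_add_le (-(a x * q' n x + G (q n x) - g x)) (G (q n x) - G (p x))
    rw [abs_neg] at h8
    exact div_le_div₀ (by positivity) (by linarith) (by linarith) hax.le
  · intro x _
    rw [tendsto_iff_dist_tendsto_zero]
    refine squeeze_zero (fun n => dist_nonneg) (fun n => ?_) hlim
    rw [Real.dist_eq]
    exact (hb n x).2.1

/-- At a local maximum of a function with derivative `f`, critical there, the derivative of `f`
is nonpositive. -/
lemma second_deriv_nonpos_of_isLocalMax {F f : ℝ → ℝ} {x₀ f' : ℝ} (hF : ∀ x, HasDerivAt F (f x) x)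
    (hf : HasDerivAt f f' x₀) (hmax : IsLocalMax F x₀) : f' ≤ 0 := by
  by_contra! hpos
  have hdF : deriv F = f := funext fun x => (hF x).deriv
  have hmin : IsLocalMin F x₀ := isLocalMin_of_deriv_deriv_pos (by rw [hdF, hf.deriv]; exact hpos)
    hmax.deriv_eq_zero (hF x₀).continuousAt
  have hconst : F =ᶠ[nhds x₀] fun _ => F x₀ := by
    filter_upwards [hmax, hmin] with x h1 h2
    exact le_antisymm h1 h2
  have h1 := hconst.deriv.deriv_eq
  rw [hdF, hf.deriv] at h1
  simp at h1
  linarith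

/-- The primitive of a profile is a viscosity solution. -/
lemma IsProfile.isViscSol {a V G p u : ℝ → ℝ} {I : Set ℝ} {β L : ℝ}
    (hp : IsProfile a (fun x => β * (1 - V x)) G I p) (ha0 : ∀ x, 0 ≤ a x)
    (hac : Continuous a) (hL0 : 0 ≤ L) (hL : ∀ x ∈ I, ∀ y ∈ I, |G x - G y| ≤ L * |x - y|)
    (hu : ∀ x, HasDerivAt u (p x) x) : IsViscSol a V G β β u := by
  have hφ1 : ∀ φ : ℝ → ℝ, ContDiff ℝ 2 φ → ∀ x, HasDerivAt φ (deriv φ x) x := fun φ h x =>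
    (h.differentiable (by norm_num) x).hasDerivAt
  have hφ2 : ∀ φ : ℝ → ℝ, ContDiff ℝ 2 φ → ∀ x, HasDerivAt (deriv φ) (deriv (deriv φ) x) x := by
    intro φ h x
    have : ContDiff ℝ 1 (deriv φ) := by
      have h2 : ContDiff ℝ (1 + 1) φ := by norm_num; exact h
      exact (contDiff_succ_iff_deriv.1 h2).2.2
    exact (this.differentiable (by norm_num) x).hasDerivAt
  refine ⟨continuous_iff_continuousAt.2 fun x => (hu x).continuousAt, ?_, ?_⟩
  · intro x₀ φ hφ hmax
    have hd : ∀ x, HasDerivAt (fun x => u x - φ x) (p x - deriv φ x) x := fun x =>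
      (hu x).sub (hφ1 φ hφ x)
    have h1 := hmax.hasDerivAt_eq_zero (hd x₀)
    have h2 : deriv φ x₀ = p x₀ := by linarith
    rw [h2]
    rcases (ha0 x₀).eq_or_lt with h | h
    · have := hp.eq_of_eq_zero hL0 hL h.symm
      rw [this, ← h]
      linarith
    · have h3 := hp.hasDerivAt hac hL0 hL h
      have h4 := second_deriv_nonpos_of_isLocalMax hd (h3.sub (hφ2 φ hφ x₀)) hmax
      rw [sub_nonpos, div_le_iff₀ h] at h4
      linarith
  · intro x₀ φ hφ hmin
    have hd : ∀ x, HasDerivAt (fun x => u x - φ x) (p x - deriv φ x) x := fun x =>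
      (hu x).sub (hφ1 φ hφ x)
    have h1 := hmin.hasDerivAt_eq_zero (hd x₀)
    have h2 : deriv φ x₀ = p x₀ := by linarith
    rw [h2]
    rcases (ha0 x₀).eq_or_lt with h | h
    · have := hp.eq_of_eq_zero hL0 hL h.symm
      rw [this, ← h]
      linarith
    · have h3 := hp.hasDerivAt hac hL0 hL h
      have h4 := second_deriv_nonpos_of_isLocalMax (fun x => (hd x).neg)
        (h3.sub (hφ2 φ hφ x₀)).neg hmin.neg
      rw [neg_nonpos, sub_nonneg, le_div_iff₀ h] at h4
      linarith

/-- Exponential decay, in the intrinsic scale `S = ∫ 1 / m`, of subsolutions of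
`a q' = r - η q` towards a level `ε > r / η`. -/
lemma le_add_exp_of_mul_deriv_le {a m S q q' : ℝ → ℝ} {ℓ₁ ℓ₂ η r ε M : ℝ}
    (hq : ∀ x, HasDerivAt q (q' x) x) (hS : ∀ x, HasDerivAt S (1 / m x) x) (hS1 : 0 ≤ S ℓ₁)
    (hS1' : S ℓ₁ ≤ 0) (hm : ∀ x, 0 < m x) (ha0 : ∀ x, 0 ≤ a x) (ham : ∀ x, a x ≤ m x)
    (hη : 0 < η) (hM : 0 ≤ M) (hε : 0 ≤ ε) (hr : r < η * ε) (hqM : q ℓ₁ ≤ M)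
    (h : ∀ x ∈ Icc ℓ₁ ℓ₂, 0 ≤ q x → a x * q' x ≤ r - η * q x) :
    ∀ x ∈ Icc ℓ₁ ℓ₂, q x ≤ ε + M * Real.exp (-η * S x) := by
  have hB : ∀ x, HasDerivAt (fun x => ε + M * Real.exp (-η * S x))
      (M * (Real.exp (-η * S x) * (-η * (1 / m x)))) x := fun x =>
    ((((hS x).const_mul (-η)).exp).const_mul M).const_add ε
  intro x hx
  refine image_le_of_deriv_right_lt_deriv_boundary (f := q) (f' := q')
    (fun x _ => (hq x).continuousAt.continuousWithinAt) (fun x _ => (hq x).hasDerivWithinAt)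
    (B := fun x => ε + M * Real.exp (-η * S x)) ?_ hB (fun z hz hqz => ?_) hx
  · have : S ℓ₁ = 0 := le_antisymm hS1' hS1
    simp [this]
    linarith
  · have hE : 0 ≤ M * Real.exp (-η * S z) := mul_nonneg hM (Real.exp_pos _).le
    have h1 := h z (Ico_subset_Icc_self hz) (by rw [hqz]; linarith)
    have h2 : a z * q' z < -η * (M * Real.exp (-η * S z)) := by
      rw [hqz] at h1
      nlinarith
    have h3 : q' z < 0 := by
      by_contra! hnn
      have := mul_nonneg (ha0 z) hnn
      nlinarith
    have h4 : m z * q' z ≤ a z * q' z := mul_le_mul_of_nonpos_right (ham z) h3.le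
    have h5 : M * (Real.exp (-η * S z) * (-η * (1 / m z))) =
        -η * (M * Real.exp (-η * S z)) / m z := by
      have := (hm z).ne'
      field_simp
    rw [h5, lt_div_iff₀ (hm z)]
    linarith

/-- The mirror image of `le_add_exp_of_mul_deriv_le`, for nonpositive functions. -/
lemma neg_le_add_exp_of_mul_deriv_le {a m S q q' : ℝ → ℝ} {ℓ₁ ℓ₂ η r ε M : ℝ}
    (hq : ∀ x, HasDerivAt q (q' x) x) (hS : ∀ x, HasDerivAt S (1 / m x) x)
    (hm : ∀ x, 0 < m x) (ha0 : ∀ x, 0 ≤ a x) (ham : ∀ x, a x ≤ m x)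
    (hη : 0 < η) (hM : 0 ≤ M) (hε : 0 ≤ ε) (hr : r < η * ε) (hqM : -M ≤ q ℓ₂)
    (h : ∀ x ∈ Icc ℓ₁ ℓ₂, q x ≤ 0 → a x * q' x ≤ r + η * q x) :
    ∀ x ∈ Icc ℓ₁ ℓ₂, -q x ≤ ε + M * Real.exp (-η * (S ℓ₂ - S x)) := by
  intro x hx
  have := le_add_exp_of_mul_deriv_le (a := fun x => a (-x)) (m := fun x => m (-x))
    (S := fun x => S ℓ₂ - S (-x)) (q := fun x => -q (-x)) (q' := fun x => q' (-x))
    (ℓ₁ := -ℓ₂) (ℓ₂ := -ℓ₁) (η := η) (r := r) (ε := ε) (M := M)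
    (fun x => by
      have := ((hq (-x)).scomp x (hasDerivAt_neg x)).neg
      exact this.congr_deriv (by simp))
    (fun x => by
      have := ((hS (-x)).scomp x (hasDerivAt_neg x)).const_sub (S ℓ₂)
      exact this.congr_deriv (by simp))
    (by simp) (by simp) (fun x => hm _) (fun x => ha0 _) (fun x => ham _) hη hM hε hr
    (by simp; linarith) (fun x hx hqx => by
      have := h (-x) ⟨by linarith [hx.2], by linarith [hx.1]⟩ (by linarith)
      linarith) (-x) ⟨by linarith [hx.2], by linarith [hx.1]⟩
  simpa using this

/-- A `C¹` cutoff with bounded derivative. -/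
lemma exists_cutoff : ∃ Θ Θ' : ℝ → ℝ, ∃ C : ℝ, (∀ t, HasDerivAt Θ (Θ' t) t) ∧ Continuous Θ' ∧
    (∀ t, 0 ≤ Θ t ∧ Θ t ≤ 1) ∧ (∀ t ≤ 0, Θ t = 0) ∧ (∀ t, 1 ≤ t → Θ t = 1) ∧
    (∀ t < 0, Θ' t = 0) ∧ (∀ t, 1 < t → Θ' t = 0) ∧ 0 ≤ C ∧ ∀ t, |Θ' t| ≤ C := by
  have hsm : ContDiff ℝ 1 Real.smoothTransition := Real.smoothTransition.contDiff
  have hc : Continuous (deriv Real.smoothTransition) := hsm.continuous_deriv le_rfl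
  have h0 : ∀ t < 0, deriv Real.smoothTransition t = 0 := by
    intro t ht
    have : Real.smoothTransition =ᶠ[nhds t] fun _ => 0 := by
      filter_upwards [Iio_mem_nhds ht] with s hs
      exact Real.smoothTransition.zero_of_nonpos (le_of_lt hs)
    rw [this.deriv_eq]
    simp
  have h1 : ∀ t, 1 < t → deriv Real.smoothTransition t = 0 := by
    intro t ht
    have : Real.smoothTransition =ᶠ[nhds t] fun _ => 1 := by
      filter_upwards [Ioi_mem_nhds ht] with s hs
      exact Real.smoothTransition.one_of_one_le (le_of_lt hs)
    rw [this.deriv_eq]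
    simp
  obtain ⟨C, hC⟩ := isCompact_Icc.exists_bound_of_continuousOn (s := Icc (0 : ℝ) 1) hc.continuousOn
  have hC0 : 0 ≤ C := (norm_nonneg _).trans (hC 0 ⟨le_rfl, zero_le_one⟩)
  refine ⟨_, _, C, fun t => (hsm.differentiable (by norm_num) t).hasDerivAt, hc,
    fun t => ⟨Real.smoothTransition.nonneg t, Real.smoothTransition.le_one t⟩,
    fun t ht => Real.smoothTransition.zero_of_nonpos ht,
    fun t ht => Real.smoothTransition.one_of_one_le ht, h0, h1, hC0, fun t => ?_⟩
  rcases lt_or_ge t 0 with h | h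
  · rw [h0 t h]; simpa using hC0
  rcases lt_or_ge 1 t with h' | h'
  · rw [h1 t h']; simpa using hC0
  exact hC t ⟨h, h'⟩

/-- Two approximate solutions that are both small in the middle third of a hill can be glued
across it. -/
lemma exists_glue {a g G m S q₁ q₁' q₂ q₂' Θ Θ' : ℝ → ℝ} {C ℓ₁ ℓ₂ y δ ε ω : ℝ}
    (hΘ : ∀ t, HasDerivAt Θ (Θ' t) t) (hΘc : Continuous Θ') (hΘ01 : ∀ t, 0 ≤ Θ t ∧ Θ t ≤ 1)
    (hΘ0 : ∀ t ≤ 0, Θ t = 0) (hΘ1 : ∀ t, 1 ≤ t → Θ t = 1) (hΘ'0 : ∀ t < 0, Θ' t = 0)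
    (hΘ'1 : ∀ t, 1 < t → Θ' t = 0) (hC0 : 0 ≤ C) (hC : ∀ t, |Θ' t| ≤ C)
    (hS : ∀ x, HasDerivAt S (1 / m x) x) (hmc : Continuous m) (hm : ∀ x, 0 < m x)
    (ha0 : ∀ x, 0 ≤ a x) (ham : ∀ x, a x ≤ m x) (hS1 : S ℓ₁ = 0) (hS2 : S ℓ₂ = y) (hy : 1 ≤ y)
    (hq₁ : ∀ x, HasDerivAt q₁ (q₁' x) x) (hq₁c : Continuous q₁')
    (hq₂ : ∀ x, HasDerivAt q₂ (q₂' x) x) (hq₂c : Continuous q₂')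
    (he₁ : ∀ x, |a x * q₁' x + G (q₁ x) - g x| ≤ δ)
    (he₂ : ∀ x, |a x * q₂' x + G (q₂ x) - g x| ≤ δ)
    (hω : ∀ s, |s| ≤ ε → 0 ≤ G s ∧ G s ≤ ω) (hε : 0 ≤ ε)
    (hmid : ∀ x ∈ Icc ℓ₁ ℓ₂, y / 3 ≤ S x → S x ≤ 2 * y / 3 → |q₁ x| ≤ ε ∧ |q₂ x| ≤ ε) :
    ∃ q q' : ℝ → ℝ, (∀ x, HasDerivAt q (q' x) x) ∧ Continuous q' ∧
      (∀ x, |a x * q' x + G (q x) - g x| ≤ δ + ω + 6 * C * ε) ∧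
      (∀ x ≤ ℓ₁, q x = q₁ x) ∧ ∀ x, ℓ₂ ≤ x → q x = q₂ x := by
  have hy0 : 0 < y := by linarith
  have hSm : StrictMono S := strictMono_of_deriv_pos fun x => by
    rw [(hS x).deriv]
    exact one_div_pos.2 (hm x)
  have hSc : Continuous S := continuous_iff_continuousAt.2 fun x => (hS x).continuousAt
  have hq₁cc : Continuous q₁ := continuous_iff_continuousAt.2 fun x => (hq₁ x).continuousAt
  have hq₂cc : Continuous q₂ := continuous_iff_continuousAt.2 fun x => (hq₂ x).continuousAt
  have hΘcc : Continuous Θ := continuous_iff_continuousAt.2 fun x => (hΘ x).continuousAt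
  set T : ℝ → ℝ := fun x => 3 / y * S x - 1 with hT
  have hTd : ∀ x, HasDerivAt T (3 / y * (1 / m x)) x := fun x =>
    ((hS x).const_mul (3 / y)).sub_const 1
  have hTc : Continuous T := by fun_prop
  have hχ : ∀ x, HasDerivAt (fun x => Θ (T x)) (Θ' (T x) * (3 / y * (1 / m x))) x := fun x =>
    (hΘ (T x)).comp x (hTd x)
  have hω0 : 0 ≤ ω := by
    have := hω 0 (by simpa using hε)
    linarith
  have hextra : 0 ≤ ω + 6 * C * ε := by positivity
  refine ⟨fun x => q₁ x + Θ (T x) * (q₂ x - q₁ x),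
    fun x => q₁' x + ((Θ' (T x) * (3 / y * (1 / m x))) * (q₂ x - q₁ x)
      + Θ (T x) * (q₂' x - q₁' x)), fun x => (hq₁ x).add ((hχ x).mul ((hq₂ x).sub (hq₁ x))),
    ?_, fun x => ?_, fun x hx => ?_, fun x hx => ?_⟩
  · have : Continuous fun x => 1 / m x := continuous_const.div hmc fun x => (hm x).ne'
    fun_prop
  · simp only
    rcases lt_or_ge (T x) 0 with h | h
    · rw [hΘ0 _ h.le, hΘ'0 _ h]
      simp only [zero_mul, add_zero]
      linarith [he₁ x]
    rcases lt_or_ge 1 (T x) with h' | h'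
    · rw [hΘ1 _ h'.le, hΘ'1 _ h']
      simp only [zero_mul, one_mul, zero_add, add_sub_cancel]
      linarith [he₂ x]
    have hTS : y * (T x + 1) = 3 * S x := by
      simp only [hT]
      field_simp
      ring
    have hSx1 : y / 3 ≤ S x := by nlinarith
    have hSx2 : S x ≤ 2 * y / 3 := by nlinarith
    have hx : x ∈ Icc ℓ₁ ℓ₂ := by
      constructor
      · rw [← hSm.le_iff_le, hS1]; linarith
      · rw [← hSm.le_iff_le, hS2]; linarith
    obtain ⟨h1, h2⟩ := hmid x hx hSx1 hSx2
    obtain ⟨hχ0, hχ1⟩ := hΘ01 (T x)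
    set χ := Θ (T x) with hχdef
    have hmix : |q₁ x + χ * (q₂ x - q₁ x)| ≤ ε := by
      rw [abs_le] at h1 h2 ⊢
      constructor <;> nlinarith
    obtain ⟨g1, g1'⟩ := hω _ h1
    obtain ⟨g2, g2'⟩ := hω _ h2
    obtain ⟨g3, g3'⟩ := hω _ hmix
    have hχ' : |a x * (Θ' (T x) * (3 / y * (1 / m x)) * (q₂ x - q₁ x))| ≤ 6 * C * ε := by
      have k1 : |q₂ x - q₁ x| ≤ 2 * ε := by
        rw [abs_le] at h1 h2 ⊢
        constructor <;> linarith
      have k2 : |a x * (1 / m x)| ≤ 1 := by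
        rw [mul_one_div, abs_of_nonneg (div_nonneg (ha0 x) (hm x).le), div_le_one (hm x)]
        exact ham x
      have k3 : |3 / y| ≤ 3 := by
        rw [abs_of_nonneg (by positivity), div_le_iff₀ hy0]
        linarith
      have k4 : a x * (Θ' (T x) * (3 / y * (1 / m x)) * (q₂ x - q₁ x)) =
        (a x * (1 / m x)) * (3 / y) * Θ' (T x) * (q₂ x - q₁ x) := by ring
      rw [k4, abs_mul, abs_mul, abs_mul]
      calc _ ≤ 1 * 3 * C * (2 * ε) := by
            have := hC (T x)
            gcongr
        _ = _ := by ring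
    have e1 := abs_le.1 (he₁ x)
    have e2 := abs_le.1 (he₂ x)
    have e3 := abs_le.1 hχ'
    have key : a x * (q₁' x + (Θ' (T x) * (3 / y * (1 / m x)) * (q₂ x - q₁ x)
        + χ * (q₂' x - q₁' x))) + G (q₁ x + χ * (q₂ x - q₁ x)) - g x =
      (1 - χ) * (a x * q₁' x + G (q₁ x) - g x) + χ * (a x * q₂' x + G (q₂ x) - g x)
        + (G (q₁ x + χ * (q₂ x - q₁ x)) - ((1 - χ) * G (q₁ x) + χ * G (q₂ x)))
        + a x * (Θ' (T x) * (3 / y * (1 / m x)) * (q₂ x - q₁ x)) := by ring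
    rw [key, abs_le]
    have h1χ : 0 ≤ 1 - χ := by linarith
    have p1 := mul_le_mul_of_nonneg_left e1.1 h1χ
    have p2 := mul_le_mul_of_nonneg_left e1.2 h1χ
    have p3 := mul_le_mul_of_nonneg_left e2.1 hχ0
    have p4 := mul_le_mul_of_nonneg_left e2.2 hχ0
    have p5 := mul_le_mul_of_nonneg_left g1' h1χ
    have p6 := mul_le_mul_of_nonneg_left g2' hχ0
    have p7 := mul_nonneg h1χ g1
    have p8 := mul_nonneg hχ0 g2
    constructor <;> linarith
  · have : T x ≤ 0 := by
      have h1 := hSm.monotone hx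
      rw [hS1] at h1
      have : 3 / y * S x ≤ 0 := mul_nonpos_of_nonneg_of_nonpos (by positivity) h1
      simp only [hT]
      linarith
    simp only
    rw [hΘ0 _ this]
    ring
  · have : 1 ≤ T x := by
      have h1 := hSm.monotone hx
      rw [hS2] at h1
      have h2 : 3 / y * y ≤ 3 / y * S x := mul_le_mul_of_nonneg_left h1 (by positivity)
      have h3 : 3 / y * y = 3 := by field_simp
      simp only [hT]
      linarith
    simp only
    rw [hΘ1 _ this]
    ring

/-- Two nonnegative-side and nonpositive-side profiles can be connected, in both orders, across a
sufficiently wide hill. -/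
lemma exists_transition {a V G p₁ p₂ : ℝ → ℝ} {η β M₁ M₂ δ : ℝ} (ha0 : ∀ x, 0 ≤ a x)
    (hac : Continuous a) (hη : 0 < η) (hGc : Continuous G) (hG0 : G 0 = 0)
    (hG1 : ∀ s, 0 ≤ s → η * s ≤ G s) (hG2 : ∀ s, s ≤ 0 → η * -s ≤ G s) (hβ : 0 ≤ β)
    (hM₁ : 0 ≤ M₁) (hM₂ : 0 ≤ M₂)
    (hp₁ : IsProfile a (fun x => β * (1 - V x)) G (Icc 0 M₁) p₁)
    (hp₂ : IsProfile a (fun x => β * (1 - V x)) G (Icc (-M₂) 0) p₂)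
    (hhill : ∀ n : ℕ, ∃ ℓ₁ ℓ₂ d : ℝ, ℓ₁ < ℓ₂ ∧ 0 < d ∧
      (∫ x in ℓ₁..ℓ₂, 1 / max (a x) d) = n + 1 ∧ ∀ x ∈ Icc ℓ₁ ℓ₂, 1 - 1 / ((n : ℝ) + 2) ≤ V x)
    (hδ : 0 < δ) :
    ∃ R : ℝ, (∃ q q' : ℝ → ℝ, (∀ x, HasDerivAt q (q' x) x) ∧ Continuous q' ∧
      (∀ x, |a x * q' x + G (q x) - β * (1 - V x)| ≤ δ) ∧
      (∀ x ≤ -R, |q x - p₁ x| ≤ δ) ∧ ∀ x, R ≤ x → |q x - p₂ x| ≤ δ) ∧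
    ∃ q q' : ℝ → ℝ, (∀ x, HasDerivAt q (q' x) x) ∧ Continuous q' ∧
      (∀ x, |a x * q' x + G (q x) - β * (1 - V x)| ≤ δ) ∧
      (∀ x ≤ -R, |q x - p₂ x| ≤ δ) ∧ ∀ x, R ≤ x → |q x - p₁ x| ≤ δ := by
  obtain ⟨Θ, Θ', C, hΘ, hΘc, hΘ01, hΘ0, hΘ1, hΘ'0, hΘ'1, hC0, hC⟩ := exists_cutoff
  obtain ⟨e, he, hGe⟩ := Metric.continuousAt_iff.1 (hGc.continuousAt (x := 0)) (δ / 3)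
    (by positivity)
  simp only [hG0, Real.dist_eq, sub_zero] at hGe
  set ε : ℝ := min (e / 2) (δ / (18 * (C + 1))) with hεdef
  have hε : 0 < ε := lt_min (by positivity) (by positivity)
  have hεC : 6 * C * ε ≤ δ / 3 := by
    have h1 : ε ≤ δ / (18 * (C + 1)) := min_le_right _ _
    rw [le_div_iff₀ (by positivity)] at h1
    nlinarith
  have hω : ∀ s, |s| ≤ ε → 0 ≤ G s ∧ G s ≤ δ / 3 := fun s hs => by
    have h1 : |s| < e := by
      have : ε ≤ e / 2 := min_le_left _ _
      linarith
    refine ⟨?_, (le_abs_self _).trans (hGe h1).le⟩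
    rcases le_total 0 s with h | h
    · exact (mul_nonneg hη.le h).trans (hG1 s h)
    · exact (mul_nonneg hη.le (neg_nonneg.2 h)).trans (hG2 s h)
  set d' : ℝ := min (δ / 3) (η * ε / 8) with hd'
  have hd'0 : 0 < d' := lt_min (by positivity) (by positivity)
  obtain ⟨q₁, q₁', hq₁, hq₁c, h₁⟩ := hp₁.2 d' hd'0
  obtain ⟨q₂, q₂', hq₂, hq₂c, h₂⟩ := hp₂.2 d' hd'0
  have hlim : Filter.Tendsto (fun n : ℕ => β / ((n : ℝ) + 2)) Filter.atTop (nhds 0) :=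
    tendsto_const_nhds.div_atTop (Filter.tendsto_atTop_add_const_right _ _
      tendsto_natCast_atTop_atTop)
  have hexp : ∀ M : ℝ, Filter.Tendsto
      (fun n : ℕ => M * Real.exp (-η * (((n : ℝ) + 1) / 3))) Filter.atTop (nhds 0) := fun M => by
    rw [show (0 : ℝ) = M * 0 by simp]
    refine Filter.Tendsto.const_mul _ (Real.tendsto_exp_atBot.comp ?_)
    refine Filter.Tendsto.const_mul_atTop_of_neg (by linarith) ?_
    exact (Filter.tendsto_atTop_add_const_right _ _ tendsto_natCast_atTop_atTop).atTop_div_const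
      (by norm_num)
  obtain ⟨n, hn1, hn2, hn3⟩ := ((hlim.eventually_lt_const (show 0 < η * ε / 8 by positivity)).and
    (((hexp M₁).eventually_lt_const (show 0 < ε / 2 by positivity)).and
      ((hexp M₂).eventually_lt_const (show 0 < ε / 2 by positivity)))).exists
  obtain ⟨ℓ₁, ℓ₂, d, hℓ, hd, hint, hV⟩ := hhill n
  set y : ℝ := (n : ℝ) + 1 with hy
  set m : ℝ → ℝ := fun x => max (a x) d with hm
  have hmc : Continuous m := by fun_prop
  have hm0 : ∀ x, 0 < m x := fun x => lt_of_lt_of_le hd (le_max_right _ _)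
  have ham : ∀ x, a x ≤ m x := fun x => le_max_left _ _
  have hinvc : Continuous fun x => 1 / m x := continuous_const.div hmc fun x => (hm0 x).ne'
  set S : ℝ → ℝ := fun z => ∫ x in ℓ₁..z, 1 / m x with hSdef
  have hS : ∀ x, HasDerivAt S (1 / m x) x := hinvc.hasDerivAt_primitive ℓ₁
  have hS1 : S ℓ₁ = 0 := by simp [hSdef]
  have hS2 : S ℓ₂ = y := hint
  have hy1 : 1 ≤ y := by
    rw [hy]
    linarith [n.cast_nonneg (α := ℝ)]
  have hg : ∀ x ∈ Icc ℓ₁ ℓ₂, β * (1 - V x) ≤ η * ε / 8 := fun x hx => by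
    have h1 : 1 - V x ≤ 1 / ((n : ℝ) + 2) := by linarith [hV x hx]
    have h2 := mul_le_mul_of_nonneg_left h1 hβ
    rw [mul_one_div] at h2
    linarith
  have hd'1 : d' ≤ η * ε / 8 := min_le_right _ _
  have hd'2 : d' ≤ δ / 3 := min_le_left _ _
  have hηε : 0 < η * ε := by positivity
  have hdec₁ : ∀ x ∈ Icc ℓ₁ ℓ₂, q₁ x ≤ ε / 2 + M₁ * Real.exp (-η * S x) :=
    le_add_exp_of_mul_deriv_le (r := η * ε / 4) hq₁ hS hS1.ge hS1.le hm0 ha0 ham hη hM₁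
      (by positivity) (by linarith) (h₁ ℓ₁).1.2 fun x hx hqx => by
        have := (abs_le.1 (h₁ x).2.2).2
        linarith [hG1 _ hqx, hg x hx]
  have hdec₂ : ∀ x ∈ Icc ℓ₁ ℓ₂, -q₂ x ≤ ε / 2 + M₂ * Real.exp (-η * (S ℓ₂ - S x)) :=
    neg_le_add_exp_of_mul_deriv_le (r := η * ε / 4) hq₂ hS hm0 ha0 ham hη hM₂
      (by positivity) (by linarith) (h₂ ℓ₂).1.1 fun x hx hqx => by
        have := (abs_le.1 (h₂ x).2.2).2
        linarith [hG2 _ hqx, hg x hx]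
  have hsmall : ∀ M, 0 ≤ M → M * Real.exp (-η * (y / 3)) < ε / 2 → ∀ s, y / 3 ≤ s →
      M * Real.exp (-η * s) ≤ ε / 2 := fun M hM h s hs => by
    refine le_trans (mul_le_mul_of_nonneg_left (Real.exp_le_exp.2 ?_) hM) h.le
    nlinarith
  have hmid : ∀ x ∈ Icc ℓ₁ ℓ₂, y / 3 ≤ S x → S x ≤ 2 * y / 3 → |q₁ x| ≤ ε ∧ |q₂ x| ≤ ε := by
    intro x hx h1 h2
    rw [abs_of_nonneg (h₁ x).1.1, abs_of_nonpos (h₂ x).1.2]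
    constructor
    · linarith [hdec₁ x hx, hsmall M₁ hM₁ hn2 _ h1]
    · linarith [hdec₂ x hx, hsmall M₂ hM₂ hn3 (S ℓ₂ - S x) (by linarith)]
  obtain ⟨q, q', hq, hqc, hqe, hql, hqr⟩ := exists_glue hΘ hΘc hΘ01 hΘ0 hΘ1 hΘ'0 hΘ'1 hC0 hC hS
    hmc hm0 ha0 ham hS1 hS2 hy1 hq₁ hq₁c hq₂ hq₂c (fun x => (h₁ x).2.2) (fun x => (h₂ x).2.2) hω
    hε.le hmid
  obtain ⟨s, s', hs, hsc, hse, hsl, hsr⟩ := exists_glue hΘ hΘc hΘ01 hΘ0 hΘ1 hΘ'0 hΘ'1 hC0 hC hS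
    hmc hm0 ha0 ham hS1 hS2 hy1 hq₂ hq₂c hq₁ hq₁c (fun x => (h₂ x).2.2) (fun x => (h₁ x).2.2) hω
    hε.le fun x hx h1 h2 => (hmid x hx h1 h2).symm
  have hR1 : -max |ℓ₁| |ℓ₂| ≤ ℓ₁ := by linarith [neg_abs_le ℓ₁, le_max_left |ℓ₁| |ℓ₂|]
  have hR2 : ℓ₂ ≤ max |ℓ₁| |ℓ₂| := (le_abs_self _).trans (le_max_right _ _)
  have hclose₁ : ∀ x, |q₁ x - p₁ x| ≤ δ := fun x => (h₁ x).2.1.trans (by linarith)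
  have hclose₂ : ∀ x, |q₂ x - p₂ x| ≤ δ := fun x => (h₂ x).2.1.trans (by linarith)
  refine ⟨max |ℓ₁| |ℓ₂|, ⟨q, q', hq, hqc, fun x => (hqe x).trans (by linarith), fun x hx => ?_,
    fun x hx => ?_⟩, ⟨s, s', hs, hsc, fun x => (hse x).trans (by linarith), fun x hx => ?_,
    fun x hx => ?_⟩⟩
  · rw [hql x (hx.trans hR1)]; exact hclose₁ x
  · rw [hqr x (hR2.trans hx)]; exact hclose₂ x
  · rw [hsl x (hx.trans hR1)]; exact hclose₂ x
  · rw [hsr x (hR2.trans hx)]; exact hclose₁ x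

/-- Transfer of linear growth between functions with asymptotically close derivatives. -/
lemma exists_le_of_deriv_close {ψ u q p : ℝ → ℝ} {R δ c C : ℝ} (hψ : ∀ x, HasDerivAt ψ (q x) x)
    (hu : ∀ x, HasDerivAt u (p x) x) (hqp : ∀ x, R ≤ x → q x - p x ≤ δ)
    (huc : ∀ x, 0 ≤ x → u x ≤ c * x + C) : ∃ C', ∀ x, 0 ≤ x → ψ x ≤ (c + δ) * x + C' := by
  set f : ℝ → ℝ := fun x => ψ x - u x - δ * x with hf
  have hfd : ∀ x, HasDerivAt f (q x - p x - δ) x := fun x =>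
    (((hψ x).sub (hu x)).sub ((hasDerivAt_id x).const_mul δ)).congr_deriv (by simp)
  have hfc : Continuous f := continuous_iff_continuousAt.2 fun x => (hfd x).continuousAt
  obtain ⟨B, hB⟩ := (isCompact_Icc (a := 0) (b := max R 0)).bddAbove_image hfc.continuousOn
  have hB' : ∀ x ∈ Icc (0 : ℝ) (max R 0), f x ≤ B := fun x hx => hB (mem_image_of_mem f hx)
  have hanti : AntitoneOn f (Ici (max R 0)) :=
    antitoneOn_of_deriv_nonpos (convex_Ici _) hfc.continuousOn
      (fun x _ => (hfd x).differentiableAt.differentiableWithinAt) fun x hx => by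
        rw [interior_Ici] at hx
        rw [(hfd x).deriv]
        linarith [hqp x ((le_max_left _ _).trans (le_of_lt hx))]
  have hfB : ∀ x, 0 ≤ x → f x ≤ B := fun x hx => by
    rcases le_total x (max R 0) with h | h
    · exact hB' x ⟨hx, h⟩
    · exact (hanti self_mem_Ici h h).trans (hB' _ ⟨le_max_right _ _, le_rfl⟩)
  refine ⟨B + C, fun x hx => ?_⟩
  have h1 := hfB x hx
  have h2 := huc x hx
  simp only [hf] at h1
  linarith

lemma exists_isLocalMax_of_lt {w : ℝ → ℝ → ℝ} {ψ : ℝ → ℝ} {c C C₀ K lam t₁ x₁ : ℝ}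
    (hw : ContinuousOn (fun p : ℝ × ℝ => w p.1 p.2) (Ici 0 ×ˢ univ)) (hψ : Continuous ψ)
    (hc : 0 < c) (hgrowth : ∀ t, 0 ≤ t → ∀ x, w t x ≤ ψ x - c * |x| + C + K * t)
    (h0 : ∀ x, w 0 x ≤ ψ x + C₀) (ht₁ : 0 ≤ t₁) (hlt : ψ x₁ + lam * t₁ + C₀ < w t₁ x₁) :
    ∃ ν t₀ x₀ : ℝ, 0 < ν ∧ 0 < t₀ ∧
      IsLocalMax (fun p : ℝ × ℝ => w p.1 p.2 - (ψ p.2 + lam * p.1 + ν * p.1 ^ 2)) (t₀, x₀) := by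
  set gap := w t₁ x₁ - (ψ x₁ + lam * t₁ + C₀) with hgap
  have hgap0 : 0 < gap := by linarith
  set ν := gap / (2 * (t₁ ^ 2 + 1)) with hν
  have hν0 : 0 < ν := by positivity
  have hνt : ν * t₁ ^ 2 < gap := by
    have : ν * (2 * (t₁ ^ 2 + 1)) = gap := by rw [hν]; field_simp
    nlinarith [mul_nonneg hν0.le (sq_nonneg t₁)]
  set F : ℝ × ℝ → ℝ := fun p => w p.1 p.2 - (ψ p.2 + lam * p.1 + ν * p.1 ^ 2) with hF
  have hFc : ContinuousOn F (Ici 0 ×ˢ univ) := hw.sub (by fun_prop)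
  have hF1 : C₀ < F (t₁, x₁) := by simp only [hF]; linarith
  set D : ℝ := C + (K - lam + 1) ^ 2 / (4 * ν) with hD
  have hFb : ∀ p ∈ Ici (0 : ℝ) ×ˢ (univ : Set ℝ), F p ≤ D - min c 1 * ‖p‖ := by
    rintro ⟨t, x⟩ ⟨ht, -⟩
    have ht : 0 ≤ t := ht
    have h1 := hgrowth t ht x
    have h2 : (K - lam + 1) * t - ν * t ^ 2 ≤ (K - lam + 1) ^ 2 / (4 * ν) := by
      rw [le_div_iff₀ (by positivity)]
      nlinarith [sq_nonneg (2 * ν * t - (K - lam + 1))]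
    have h3 : min c 1 * ‖(t, x)‖ ≤ c * |x| + t := by
      have hm : 0 ≤ min c 1 := le_min hc.le zero_le_one
      rw [Prod.norm_def]
      simp only [Real.norm_eq_abs, abs_of_nonneg ht]
      rw [mul_max_of_nonneg _ _ hm]
      refine max_le ?_ ?_
      · nlinarith [min_le_right c 1, mul_nonneg hc.le (abs_nonneg x)]
      · nlinarith [min_le_left c 1, abs_nonneg x]
    simp only [hF]
    linarith
  have hev : ∀ᶠ p in Filter.cocompact (ℝ × ℝ) ⊓ Filter.principal (Ici 0 ×ˢ univ),
      F p ≤ F (t₁, x₁) := by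
    rw [Filter.eventually_inf_principal]
    have hlim : Filter.Tendsto (fun p : ℝ × ℝ => D - min c 1 * ‖p‖) (Filter.cocompact _)
        Filter.atBot := by
      refine Filter.tendsto_atBot_add_const_left _ D ?_
      exact Filter.tendsto_neg_atTop_atBot.comp
        (tendsto_norm_cocompact_atTop.const_mul_atTop (lt_min hc zero_lt_one))
    filter_upwards [hlim.eventually_le_atBot (F (t₁, x₁))] with p hp hps
    exact (hFb p hps).trans hp
  obtain ⟨⟨t₀, x₀⟩, ⟨ht₀, -⟩, hmax⟩ := hFc.exists_isMaxOn'
    (isClosed_Ici.prod isClosed_univ) (x₀ := (t₁, x₁)) ⟨ht₁, mem_univ _⟩ hev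
  have hmax1 : C₀ < F (t₀, x₀) := hF1.trans_le (hmax ⟨ht₁, mem_univ _⟩)
  have ht₀' : 0 < t₀ := by
    refine lt_of_le_of_ne ht₀ fun h => ?_
    rw [← h] at hmax1
    simp only [hF] at hmax1
    have := h0 x₀
    linarith
  exact ⟨ν, t₀, x₀, hν0, ht₀', hmax.isLocalMax (prod_mem_nhds (Ici_mem_nhds ht₀') Filter.univ_mem)⟩

lemma contDiff_two_primitive {ψ q q' : ℝ → ℝ} (hψ : ∀ x, HasDerivAt ψ (q x) x)
    (hq : ∀ x, HasDerivAt q (q' x) x) (hq' : Continuous q') : ContDiff ℝ 2 ψ := by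
  have hd : deriv ψ = q := funext fun x => (hψ x).deriv
  have hd' : deriv q = q' := funext fun x => (hq x).deriv
  rw [show (2 : WithTop ℕ∞) = 1 + 1 by norm_num, contDiff_succ_iff_deriv, hd]
  refine ⟨fun x => (hψ x).differentiableAt, by simp, ?_⟩
  rw [contDiff_one_iff_deriv, hd']
  exact ⟨fun x => (hq x).differentiableAt, hq'⟩

/-- Derivatives of the test function `ψ x + λ t + ν t ^ 2`. -/
lemma parabolic_test_function {ψ q q' : ℝ → ℝ} (lam ν : ℝ) (hψ : ∀ x, HasDerivAt ψ (q x) x)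
    (hq : ∀ x, HasDerivAt q (q' x) x) (hq' : Continuous q') :
    ContDiff ℝ 2 (fun p : ℝ × ℝ => ψ p.2 + lam * p.1 + ν * p.1 ^ 2) ∧
    ∀ t x, deriv (fun t => ψ x + lam * t + ν * t ^ 2) t = lam + 2 * ν * t ∧
      deriv (fun x => ψ x + lam * t + ν * t ^ 2) x = q x ∧
      deriv (deriv (fun x => ψ x + lam * t + ν * t ^ 2)) x = q' x := by
  have hψ2 := contDiff_two_primitive hψ hq hq'
  refine ⟨by fun_prop, fun t x => ⟨?_, ?_, ?_⟩⟩
  · have : HasDerivAt (fun t => ψ x + lam * t + ν * t ^ 2) (lam * 1 + ν * (2 * t)) t := by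
      refine (((hasDerivAt_id t).const_mul lam).const_add _).add ?_
      exact ((hasDerivAt_pow 2 t).const_mul ν).congr_deriv (by norm_num)
    rw [this.deriv]
    ring
  · exact (((hψ x).add_const _).add_const _).deriv
  · have : deriv (fun x => ψ x + lam * t + ν * t ^ 2) = q :=
      funext fun x => (((hψ x).add_const _).add_const _).deriv
    rw [this, (hq x).deriv]

lemma IsParabolicViscSol.le_of_supersolution {a V G ψ q q' : ℝ → ℝ} {w : ℝ → ℝ → ℝ}
    {β δ θ c C K : ℝ} (hw : IsParabolicViscSol a V G β w) (hc : 0 < c)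
    (hw0 : ∀ x, w 0 x = θ * x) (hwK : ∀ t, 0 ≤ t → ∀ x, w t x ≤ θ * x + K * t)
    (hψ : ∀ x, HasDerivAt ψ (q x) x) (hq : ∀ x, HasDerivAt q (q' x) x) (hq' : Continuous q')
    (he : ∀ x, a x * q' x + G (q x) + β * V x ≤ β + δ)
    (hψθ : ∀ x, θ * x + c * |x| - C ≤ ψ x) :
    ∀ t, 0 ≤ t → w t 0 ≤ (β + δ) * t + (ψ 0 + C) := by
  by_contra! hcon
  obtain ⟨t₁, ht₁, hlt⟩ := hcon
  obtain ⟨ν, t₀, x₀, hν, ht₀, hmax⟩ := exists_isLocalMax_of_lt (c := c) (C := C) (C₀ := C) (K := K)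
    (lam := β + δ) (x₁ := 0) hw.1
    (continuous_iff_continuousAt.2 fun x => (hψ x).continuousAt) hc
    (fun t ht x => by linarith [hwK t ht x, hψθ x])
    (fun x => by rw [hw0]; nlinarith [hψθ x, abs_nonneg x]) ht₁ (by linarith)
  obtain ⟨hφ, hder⟩ := parabolic_test_function (β + δ) ν hψ hq hq'
  have := hw.2.1 t₀ x₀ ht₀ _ hφ hmax
  obtain ⟨h1, h2, h3⟩ := hder t₀ x₀
  simp only [h1, h2, h3] at this
  nlinarith [he x₀, mul_pos hν ht₀]

lemma IsParabolicViscSol.ge_of_subsolution {a V G ψ q q' : ℝ → ℝ} {w : ℝ → ℝ → ℝ}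
    {β δ θ c C K : ℝ} (hw : IsParabolicViscSol a V G β w) (hc : 0 < c)
    (hw0 : ∀ x, w 0 x = θ * x) (hwK : ∀ t, 0 ≤ t → ∀ x, θ * x - K * t ≤ w t x)
    (hψ : ∀ x, HasDerivAt ψ (q x) x) (hq : ∀ x, HasDerivAt q (q' x) x) (hq' : Continuous q')
    (he : ∀ x, β - δ ≤ a x * q' x + G (q x) + β * V x)
    (hψθ : ∀ x, ψ x ≤ θ * x - c * |x| + C) :
    ∀ t, 0 ≤ t → (β - δ) * t + (ψ 0 - C) ≤ w t 0 := by
  by_contra! hcon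
  obtain ⟨t₁, ht₁, hlt⟩ := hcon
  obtain ⟨ν, t₀, x₀, hν, ht₀, hmax⟩ := exists_isLocalMax_of_lt (w := fun t x => -w t x)
    (ψ := fun x => -ψ x) (c := c) (C := C) (C₀ := C) (K := K) (lam := -(β - δ)) (x₁ := 0) hw.1.neg
    (continuous_iff_continuousAt.2 fun x => (hψ x).continuousAt.neg) hc
    (fun t ht x => by linarith [hwK t ht x, hψθ x])
    (fun x => by rw [hw0]; nlinarith [hψθ x, abs_nonneg x]) ht₁ (by linarith)
  obtain ⟨hφ, hder⟩ := parabolic_test_function (β - δ) (-ν) hψ hq hq'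
  have hmin : IsLocalMin (fun p : ℝ × ℝ => w p.1 p.2 -
      (ψ p.2 + (β - δ) * p.1 + -ν * p.1 ^ 2)) (t₀, x₀) := by
    filter_upwards [hmax] with p hp
    linarith
  have := hw.2.2 t₀ x₀ ht₀ _ hφ hmin
  obtain ⟨h1, h2, h3⟩ := hder t₀ x₀
  simp only [h1, h2, h3] at this
  nlinarith [he x₀, mul_pos hν ht₀]

lemma tendsto_div_of_linear_bounds {f : ℝ → ℝ} {β : ℝ}
    (h : ∀ δ : ℝ, 0 < δ → ∃ C C', ∀ t, 0 ≤ t →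
      f t ≤ (β + δ) * t + C ∧ (β - δ) * t + C' ≤ f t) :
    Filter.Tendsto (fun t => f t / t) Filter.atTop (nhds β) := by
  rw [Metric.tendsto_atTop]
  intro e he
  obtain ⟨C, C', hC⟩ := h (e / 2) (by positivity)
  refine ⟨2 * (|C| + |C'| + 1) / e, fun t ht => ?_⟩
  have ht0 : 0 < t := lt_of_lt_of_le (by positivity) ht
  rw [ge_iff_le, div_le_iff₀ he] at ht
  obtain ⟨h1, h2⟩ := hC t ht0.le
  rw [Real.dist_eq, abs_lt]
  have e1 : f t / t - β = (f t - β * t) / t := by field_simp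
  rw [e1, lt_div_iff₀ ht0, div_lt_iff₀ ht0]
  constructor
  · nlinarith [neg_abs_le C', abs_nonneg C]
  · nlinarith [le_abs_self C, abs_nonneg C']

/-- Convergence of `w t 0 / t` to `β`, given profiles on both sides of a hill whose primitives
have the right linear growth. -/
lemma IsParabolicViscSol.tendsto_div {a V G p₁ p₂ u₁ u₂ : ℝ → ℝ} {w : ℝ → ℝ → ℝ}
    {η β M₁ M₂ θ θ₁ θ₂ C₁ C₂ C₃ C₄ K : ℝ} (hw : IsParabolicViscSol a V G β w)
    (hw0 : ∀ x, w 0 x = θ * x) (hwK : ∀ t, 0 ≤ t → ∀ x, |w t x - θ * x| ≤ K * t)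
    (ha0 : ∀ x, 0 ≤ a x)
    (hac : Continuous a) (hη : 0 < η) (hGc : Continuous G) (hG0 : G 0 = 0)
    (hG1 : ∀ s, 0 ≤ s → η * s ≤ G s) (hG2 : ∀ s, s ≤ 0 → η * -s ≤ G s) (hβ : 0 ≤ β)
    (hM₁ : 0 ≤ M₁) (hM₂ : 0 ≤ M₂)
    (hp₁ : IsProfile a (fun x => β * (1 - V x)) G (Icc 0 M₁) p₁)
    (hp₂ : IsProfile a (fun x => β * (1 - V x)) G (Icc (-M₂) 0) p₂)
    (hhill : ∀ n : ℕ, ∃ ℓ₁ ℓ₂ d : ℝ, ℓ₁ < ℓ₂ ∧ 0 < d ∧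
      (∫ x in ℓ₁..ℓ₂, 1 / max (a x) d) = n + 1 ∧ ∀ x ∈ Icc ℓ₁ ℓ₂, 1 - 1 / ((n : ℝ) + 2) ≤ V x)
    (hu₁ : ∀ x, HasDerivAt u₁ (p₁ x) x) (hu₂ : ∀ x, HasDerivAt u₂ (p₂ x) x)
    (hθ₁ : θ < θ₁) (hθ₂ : θ₂ < θ)
    (hg₁ : ∀ x, 0 ≤ x → -u₁ x ≤ -θ₁ * x + C₁) (hg₂ : ∀ x, 0 ≤ x → u₁ (-x) ≤ -θ₁ * x + C₂)
    (hg₃ : ∀ x, 0 ≤ x → u₂ x ≤ θ₂ * x + C₃) (hg₄ : ∀ x, 0 ≤ x → -u₂ (-x) ≤ θ₂ * x + C₄) :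
    Filter.Tendsto (fun t => w t 0 / t) Filter.atTop (nhds β) := by
  refine tendsto_div_of_linear_bounds fun δ₀ hδ₀ => ?_
  set δ : ℝ := min δ₀ (min ((θ₁ - θ) / 2) ((θ - θ₂) / 2)) with hδdef
  have hδ : 0 < δ := lt_min hδ₀ (lt_min (by linarith) (by linarith))
  have hδ1 : δ ≤ δ₀ := min_le_left _ _
  have hδ2 : δ ≤ (θ₁ - θ) / 2 := (min_le_right _ _).trans (min_le_left _ _)
  have hδ3 : δ ≤ (θ - θ₂) / 2 := (min_le_right _ _).trans (min_le_right _ _)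
  have hneg : ∀ {f f' : ℝ → ℝ}, (∀ x, HasDerivAt f (f' x) x) →
      ∀ x, HasDerivAt (fun x => -f x) (-f' x) x := fun h x => (h x).neg
  have hrefl : ∀ {f f' : ℝ → ℝ}, (∀ x, HasDerivAt f (f' x) x) →
      ∀ x, HasDerivAt (fun x => f (-x)) (-f' (-x)) x := fun h x =>
    ((h (-x)).scomp x (hasDerivAt_neg x)).congr_deriv (by simp)
  obtain ⟨R, ⟨q, q', hq, hqc, hqe, hql, hqr⟩, ⟨s, s', hs, hsc, hse, hsl, hsr⟩⟩ :=
    exists_transition ha0 hac hη hGc hG0 hG1 hG2 hβ hM₁ hM₂ hp₁ hp₂ hhill hδ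
  have hqcc : Continuous q := continuous_iff_continuousAt.2 fun x => (hq x).continuousAt
  have hscc : Continuous s := continuous_iff_continuousAt.2 fun x => (hs x).continuousAt
  have hψ := hqcc.hasDerivAt_primitive 0
  have hχ := hscc.hasDerivAt_primitive 0
  set ψ : ℝ → ℝ := fun z => ∫ y in (0 : ℝ)..z, q y
  set χ : ℝ → ℝ := fun z => ∫ y in (0 : ℝ)..z, s y
  obtain ⟨A₁, hA₁⟩ := exists_le_of_deriv_close (R := R) (δ := δ) hψ hu₂
    (fun x hx => (abs_le.1 (hqr x hx)).2) hg₃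
  obtain ⟨A₂, hA₂⟩ := exists_le_of_deriv_close (R := R) (δ := δ) (hrefl hψ) (hrefl hu₁)
    (fun x hx => by linarith [(abs_le.1 (hql (-x) (neg_le_neg hx))).1]) hg₂
  obtain ⟨A₃, hA₃⟩ := exists_le_of_deriv_close (R := R) (δ := δ) (hneg hχ) (hneg hu₁)
    (fun x hx => by linarith [(abs_le.1 (hsr x hx)).1]) hg₁
  obtain ⟨A₄, hA₄⟩ := exists_le_of_deriv_close (R := R) (δ := δ) (hneg (hrefl hχ))
    (hneg (hrefl hu₂)) (fun x hx => by linarith [(abs_le.1 (hsl (-x) (neg_le_neg hx))).2]) hg₄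
  have hsub := hw.ge_of_subsolution (δ := δ) (c := δ) (C := max A₁ A₂) (K := K) hδ hw0
    (fun t ht x => by linarith [(abs_le.1 (hwK t ht x)).1]) hψ hq hqc
    (fun x => by linarith [(abs_le.1 (hqe x)).1]) fun x => by
      rcases le_total 0 x with hx | hx
      · rw [abs_of_nonneg hx]
        have := mul_le_mul_of_nonneg_right hδ3 hx
        linarith [hA₁ x hx, le_max_left A₁ A₂]
      · have hx' := neg_nonneg.2 hx
        have h1 := hA₂ (-x) hx'
        have h2 := mul_le_mul_of_nonneg_right hδ2 hx'
        rw [abs_of_nonpos hx]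
        simp only [neg_neg] at h1
        linarith [le_max_right A₁ A₂]
  have hsup := hw.le_of_supersolution (δ := δ) (c := δ) (C := max A₃ A₄) (K := K) hδ hw0
    (fun t ht x => by linarith [(abs_le.1 (hwK t ht x)).2]) hχ hs hsc
    (fun x => by linarith [(abs_le.1 (hse x)).2]) fun x => by
      rcases le_total 0 x with hx | hx
      · rw [abs_of_nonneg hx]
        have := mul_le_mul_of_nonneg_right hδ2 hx
        linarith [hA₃ x hx, le_max_left A₃ A₄]
      · have hx' := neg_nonneg.2 hx
        have h1 := hA₄ (-x) hx'
        have h2 := mul_le_mul_of_nonneg_right hδ3 hx'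
        rw [abs_of_nonpos hx]
        simp only [neg_neg] at h1
        linarith [le_max_right A₃ A₄]
  refine ⟨χ 0 + max A₃ A₄, ψ 0 - max A₁ A₂, fun t ht => ⟨(hsup t ht).trans ?_, le_trans ?_ (hsub t ht)⟩⟩
  · have := mul_le_mul_of_nonneg_right hδ1 ht
    linarith
  · have := mul_le_mul_of_nonneg_right hδ1 ht
    linarith

/-- Maximal ergodic theorem. -/
lemma integral_nonneg_of_birkhoffSum_pos {Ω : Type*} [MeasurableSpace Ω] {P : Measure Ω}
    [IsFiniteMeasure P] {T : Ω → Ω} (hT : MeasurePreserving T P P) {f : Ω → ℝ}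
    (hfm : Measurable f) (hf : Integrable f P)
    (hpos : ∀ᵐ ω ∂P, ∃ n : ℕ, 0 < birkhoffSum T f n ω) : 0 ≤ ∫ ω, f ω ∂P := by
  let M : ℕ → Ω → ℝ := fun n => Nat.rec (fun _ => 0) (fun _ g ω => max (f ω + g (T ω)) 0) n
  have hM0 : ∀ ω, M 0 ω = 0 := fun ω => rfl
  have hMs : ∀ n ω, M (n + 1) ω = max (f ω + M n (T ω)) 0 := fun n ω => rfl
  have hMnn : ∀ n ω, 0 ≤ M n ω := by
    rintro (_ | n) ω
    · exact le_rfl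
    · exact le_max_right _ _
  have hMmono : ∀ n ω, M n ω ≤ M (n + 1) ω := by
    intro n
    induction n with
    | zero => exact fun ω => hMnn 1 ω
    | succ n ih =>
      intro ω
      rw [hMs, hMs (n + 1)]
      exact max_le_max (by linarith [ih (T ω)]) le_rfl
  have hMm : ∀ n, Measurable (M n) := by
    intro n
    induction n with
    | zero => exact measurable_const
    | succ n ih => exact (hfm.add (ih.comp hT.measurable)).max measurable_const
  have hMi : ∀ n, Integrable (M n) P := by
    intro n
    induction n with
    | zero => exact integrable_zero _ _ _
    | succ n ih => exact (hf.add (hT.integrable_comp_of_integrable ih)).pos_part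
  have hSM : ∀ n ω, birkhoffSum T f n ω ≤ M n ω := by
    intro n
    induction n with
    | zero => intro ω; simp [hM0]
    | succ n ih =>
      intro ω
      rw [birkhoffSum_succ', hMs]
      exact le_max_of_le_left (by linarith [ih (T ω)])
  have hset : ∀ n, MeasurableSet {ω | 0 < M n ω} := fun n =>
    measurableSet_lt measurable_const (hMm n)
  have hn : ∀ n, 0 ≤ ∫ ω, {ω | 0 < M n ω}.indicator f ω ∂P := by
    intro n
    have hMT : Integrable (fun ω => M n (T ω)) P := hT.integrable_comp_of_integrable (hMi n)
    have h1 : ∫ ω, (M n ω - M n (T ω)) ∂P = 0 := by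
      rw [integral_sub (hMi n) hMT, sub_eq_zero]
      conv_lhs => rw [← hT.map_eq]
      exact integral_map hT.aemeasurable (hMm n).aestronglyMeasurable
    have hle : ∀ ω, M n ω - M n (T ω) ≤ {ω | 0 < M n ω}.indicator f ω := by
      intro ω
      rcases lt_or_ge 0 (M n ω) with h | h
      · rw [indicator_of_mem (show ω ∈ {ω | 0 < M n ω} from h)]
        cases n with
        | zero => exact absurd h (lt_irrefl _)
        | succ n =>
          have h2 := hMs n ω
          have h3 : M (n + 1) ω = f ω + M n (T ω) := by
            rcases max_choice (f ω + M n (T ω)) 0 with h' | h' <;> rw [h'] at h2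
            · exact h2
            · exact absurd h2 h.ne'
          have h4 := hMmono n (T ω)
          linarith
      · rw [indicator_of_notMem (show ω ∉ {ω | 0 < M n ω} from h.not_gt)]
        linarith [hMnn n (T ω)]
    exact h1.ge.trans (integral_mono ((hMi n).sub hMT) (hf.indicator (hset n)) hle)
  refine ge_of_tendsto' (tendsto_integral_of_dominated_convergence (fun ω => |f ω|)
    (fun n => (hfm.indicator (hset n)).aestronglyMeasurable) hf.abs
    (fun n => .of_forall fun ω => norm_indicator_le_norm_self _ _) ?_) hn
  filter_upwards [hpos] with ω hω
  obtain ⟨n, hn⟩ := hω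
  refine tendsto_const_nhds.congr' ?_
  filter_upwards [Filter.eventually_ge_atTop n] with k hk
  have : M n ω ≤ M k ω := monotone_nat_of_le_succ (f := fun n => M n ω) (fun n => hMmono n ω) hk
  exact (indicator_of_mem (show ω ∈ {ω | 0 < M k ω} from (hn.trans_le (hSM n ω)).trans_le this)
    f).symm

/-- An upper bound from the ergodic theorem: a Lipschitz cocycle grows at most linearly, at any
rate exceeding its mean. -/
lemma ae_exists_le_of_integral_lt {Ω : Type*} [MeasurableSpace Ω] {P : Measure Ω}
    [IsProbabilityMeasure P] {τ : ℝ → Ω → Ω} (hτ_zero : ∀ ω, τ 0 ω = ω)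
    (hτ_add : ∀ x y : ℝ, ∀ ω, τ (x + y) ω = τ x (τ y ω))
    (hτ_mp : ∀ x : ℝ, MeasurePreserving (τ x) P P)
    (hτ_erg : ∀ g : Ω → ℝ, Measurable g →
      (∀ x : ℝ, ∀ᵐ ω ∂P, g (τ x ω) = g ω) → ∃ c : ℝ, ∀ᵐ ω ∂P, g ω = c)
    {u : ℝ → Ω → ℝ} (hu : ∀ x, Measurable (u x))
    (hcoc : ∀ x y ω, u (x + y) ω = u y ω + u x (τ y ω)) {M : ℝ}
    (hlip : ∀ ω x y, |u x ω - u y ω| ≤ M * |x - y|) {c : ℝ} (hc : ∫ ω, u 1 ω ∂P < c) :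
    ∀ᵐ ω ∂P, ∃ C, ∀ x, 0 ≤ x → u x ω ≤ c * x + C := by
  have hu0 : ∀ ω, u 0 ω = 0 := fun ω => by
    have := hcoc 0 0 ω
    rw [hτ_zero, add_zero] at this
    linarith
  have hM : 0 ≤ M := by
    obtain ⟨ω⟩ := nonempty_of_isProbabilityMeasure P
    simpa using (abs_nonneg _).trans (hlip ω 1 0)
  set B : Set Ω := {ω | ∀ C : ℕ, ∃ n : ℕ, (C : ℝ) < u n ω - c * n} with hB
  have hBm : MeasurableSet B := by
    simp only [hB, ofPred_forall, ofPred_exists]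
    exact MeasurableSet.iInter fun C => MeasurableSet.iUnion fun n =>
      measurableSet_lt measurable_const ((hu n).sub_const _)
  have hBinv : ∀ y ω, ω ∈ B → τ y ω ∈ B := by
    intro y ω hω C
    obtain ⟨N, hN⟩ := exists_nat_gt (2 * (M * |y|))
    obtain ⟨n, hn⟩ := hω (C + N)
    refine ⟨n, ?_⟩
    push_cast at hn
    have h1 := hcoc n y ω
    have h2 := (abs_le.1 (hlip ω (n + y) n)).1
    have h3 := (abs_le.1 (hlip ω y 0)).2
    rw [hu0, sub_zero, sub_zero] at h3
    rw [add_sub_cancel_left] at h2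
    linarith
  have hBiff : ∀ y ω, τ y ω ∈ B ↔ ω ∈ B := fun y ω => by
    refine ⟨fun h => ?_, hBinv y ω⟩
    have := hBinv (-y) _ h
    rwa [← hτ_add, neg_add_cancel, hτ_zero] at this
  obtain ⟨c₀, hc₀⟩ := hτ_erg (B.indicator fun _ => 1) (measurable_const.indicator hBm)
    fun x => .of_forall fun ω => by
      by_cases h : ω ∈ B
      · rw [indicator_of_mem h, indicator_of_mem ((hBiff x ω).2 h)]
      · rw [indicator_of_notMem h, indicator_of_notMem (mt (hBiff x ω).1 h)]
  by_cases h1 : c₀ = 1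
  · exfalso
    have hi : Integrable (u 1) P := by
      refine Integrable.of_bound (hu 1).aestronglyMeasurable M (.of_forall fun ω => ?_)
      simpa [hu0] using hlip ω 1 0
    have hf : Integrable (fun ω => u 1 ω - c) P := by
      exact hi.sub (integrable_const _)
    have hS : ∀ (n : ℕ) ω, birkhoffSum (τ 1) (fun ω => u 1 ω - c) n ω = u n ω - c * n := by
      intro n
      induction n with
      | zero => intro ω; simp [hu0]
      | succ n ih =>
        intro ω
        rw [birkhoffSum_succ', ih]
        push_cast
        rw [hcoc]
        ring
    have := integral_nonneg_of_birkhoffSum_pos (hτ_mp 1) ((hu 1).sub_const c) hf (by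
      filter_upwards [hc₀] with ω hω
      have hωB : ω ∈ B := by
        by_contra h
        rw [indicator_of_notMem h, h1] at hω
        exact zero_ne_one hω
      obtain ⟨n, hn⟩ := hωB 0
      exact ⟨n, by rw [hS]; exact_mod_cast hn⟩)
    rw [integral_sub hi (integrable_const _)] at this
    simp at this
    linarith
  · filter_upwards [hc₀] with ω hω
    have hωB : ω ∉ B := fun h => by
      rw [indicator_of_mem h] at hω
      exact h1 hω.symm
    simp only [hB, mem_ofPred_eq] at hωB
    push Not at hωB
    obtain ⟨C, hC⟩ := hωB
    refine ⟨|c| + C + M, fun x hx => ?_⟩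
    have hn1 := Nat.floor_le hx
    have hn2 := Nat.lt_floor_add_one x
    set n := ⌊x⌋₊
    have h2 := (abs_le.1 (hlip ω x n)).2
    have h3 : M * |x - n| ≤ M := by
      rw [abs_of_nonneg (by linarith)]
      nlinarith
    have h4 : c * n - c * x ≤ |c| := by
      rw [← mul_sub]
      refine (le_abs_self _).trans ?_
      rw [abs_mul]
      have : |(n : ℝ) - x| ≤ 1 := by
        rw [abs_le]
        constructor <;> linarith
      nlinarith [abs_nonneg c]
    linarith [hC n]

/-- The mean derivative at the origin of a Lipschitz cocycle is its mean increment. -/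
lemma integral_eq_integral_of_hasDerivAt {Ω : Type*} [MeasurableSpace Ω] {P : Measure Ω}
    [IsProbabilityMeasure P] {τ : ℝ → Ω → Ω}
    (hτ_mp : ∀ x : ℝ, MeasurePreserving (τ x) P P)
    {u : ℝ → Ω → ℝ} (hu : ∀ x, Measurable (u x)) (hu0 : ∀ ω, u 0 ω = 0)
    (hcoc : ∀ x y ω, u (x + y) ω = u y ω + u x (τ y ω)) {M : ℝ}
    (hlip : ∀ ω x y, |u x ω - u y ω| ≤ M * |x - y|) {p : Ω → ℝ}
    (hp : ∀ ω, HasDerivAt (fun x => u x ω) (p ω) 0) :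
    ∫ ω, p ω ∂P = ∫ ω, u 1 ω ∂P ∧ ∫ ω, u (-1) ω ∂P = -∫ ω, u 1 ω ∂P := by
  have hb : ∀ x ω, |u x ω| ≤ M * |x| := fun x ω => by simpa [hu0] using hlip ω x 0
  have hi : ∀ x, Integrable (u x) P := fun x =>
    Integrable.of_bound (hu x).aestronglyMeasurable (M * |x|) (.of_forall fun ω => hb x ω)
  set A : ℝ → ℝ := fun x => ∫ ω, u x ω ∂P with hA
  have hadd : ∀ x y, A (x + y) = A y + A x := fun x y => by
    have hiτ : Integrable (fun ω => u x (τ y ω)) P :=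
      (hτ_mp y).integrable_comp_of_integrable (hi x)
    simp only [hA, hcoc]
    rw [integral_add (hi y) hiτ]
    congr 1
    conv_rhs => rw [← (hτ_mp y).map_eq]
    exact (integral_map (hτ_mp y).aemeasurable (hu x).aestronglyMeasurable).symm
  have hA0 : A 0 = 0 := by simp [hA, hu0]
  have hmul : ∀ (n : ℕ) x, A (n * x) = n * A x := by
    intro n x
    induction n with
    | zero => simp [hA0]
    | succ n ih =>
      push_cast
      rw [add_mul, one_mul, hadd, ih]
      ring
  refine ⟨?_, ?_⟩
  · have hlim : Filter.Tendsto (fun n : ℕ => ∫ ω, ((n : ℝ) + 1) * u (1 / ((n : ℝ) + 1)) ω ∂P)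
        Filter.atTop (nhds (∫ ω, p ω ∂P)) := by
      refine tendsto_integral_of_dominated_convergence (fun _ => M)
        (fun n => ((hu _).const_mul _).aestronglyMeasurable) (integrable_const _)
        (fun n => .of_forall fun ω => ?_) (.of_forall fun ω => ?_)
      · have hn : (0 : ℝ) < n + 1 := by positivity
        rw [Real.norm_eq_abs, abs_mul, abs_of_pos hn]
        have := hb (1 / ((n : ℝ) + 1)) ω
        rw [abs_of_pos (one_div_pos.2 hn), mul_one_div, le_div_iff₀ hn] at this
        linarith
      · have h1 := (hp ω).tendsto_slope_zero
        have h2 : Filter.Tendsto (fun n : ℕ => 1 / ((n : ℝ) + 1)) Filter.atTop (nhdsWithin 0 {0}ᶜ) :=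
          tendsto_nhdsWithin_iff.2 ⟨tendsto_one_div_add_atTop_nhds_zero_nat,
            .of_forall fun n => (by positivity : (1 / ((n : ℝ) + 1)) ≠ 0)⟩
        refine (h1.comp h2).congr fun n => ?_
        simp [hu0]
    refine tendsto_nhds_unique hlim (tendsto_const_nhds.congr fun n => ?_)
    have hn : (n : ℝ) + 1 ≠ 0 := by positivity
    rw [integral_const_mul]
    have := hmul (n + 1) (1 / ((n : ℝ) + 1))
    push_cast at this
    rw [mul_one_div_cancel hn] at this
    exact this
  · have := hadd (-1) 1
    rw [neg_add_cancel, hA0] at this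
    simp only [hA] at this
    linarith

lemma MemGsqc.neg {G : ℝ → ℝ} (hG : MemGsqc G) : MemGsqc fun s => G (-s) := by
  obtain ⟨⟨α₀, α₁, γ, h0, h1, hγ, hb, hl⟩, hz, η, hη, hr⟩ := hG
  refine ⟨⟨α₀, α₁, γ, h0, h1, hγ, fun p => ?_, fun p q => ?_⟩, by simpa using hz, η, hη,
    fun p q hp hpq => ?_⟩
  · simpa using hb (-p)
  · have := hl (-p) (-q)
    rwa [abs_neg, abs_neg, ← abs_neg (-p - -q), show -(-p - -q) = p - q by ring] at this
  · simpa using (hr p q hp hpq).symm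

lemma MemGsqc.exists_lipschitz {G : ℝ → ℝ} (hG : MemGsqc G) (R : ℝ) :
    ∃ L, 0 ≤ L ∧ ∀ x y, |x| ≤ R → |y| ≤ R → |G x - G y| ≤ L * |x - y| := by
  obtain ⟨⟨α₀, α₁, γ, -, h1, hγ, -, hl⟩, -⟩ := hG
  refine ⟨α₁ * (|R| + |R| + 1) ^ (γ - 1), by positivity, fun x y hx hy => (hl x y).trans ?_⟩
  have hR := le_abs_self R
  have : (|x| + |y| + 1) ^ (γ - 1) ≤ (|R| + |R| + 1) ^ (γ - 1) :=
    Real.rpow_le_rpow (by positivity) (by linarith) (by linarith)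
  gcongr

lemma MemGsqc.continuous {G : ℝ → ℝ} (hG : MemGsqc G) : Continuous G := by
  refine continuous_iff_continuousAt.2 fun x => ?_
  obtain ⟨L, hL, h⟩ := hG.exists_lipschitz (|x| + 1)
  have hlip : LipschitzOnWith L.toNNReal G (Metric.ball x 1) := by
    refine LipschitzOnWith.of_dist_le_mul fun y hy z hz => ?_
    have hb : ∀ w ∈ Metric.ball x 1, |w| ≤ |x| + 1 := fun w hw => by
      rw [Metric.mem_ball, Real.dist_eq] at hw
      have := abs_sub_abs_le_abs_sub w x
      linarith
    rw [Real.dist_eq, Real.dist_eq, Real.coe_toNNReal _ hL]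
    exact h y z (hb y hy) (hb z hz)
  exact hlip.continuousOn.continuousAt (Metric.ball_mem_nhds x one_pos)

lemma MemGsqc.exists_rate {G : ℝ → ℝ} (hG : MemGsqc G) : ∃ η, 0 < η ∧
    (∀ x y, 0 ≤ x → x ≤ y → η * (y - x) ≤ G y - G x) ∧
    (∀ s, 0 ≤ s → η * s ≤ G s) ∧ ∀ s, s ≤ 0 → η * -s ≤ G s := by
  obtain ⟨-, hz, η, hη, hr⟩ := hG
  have h1 : ∀ x y, 0 ≤ x → x ≤ y →
      η * (y - x) ≤ G y - G x ∧ η * (y - x) ≤ G (-y) - G (-x) := by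
    intro x y hx hxy
    rcases hxy.eq_or_lt with rfl | h
    · simp
    · exact hr x y hx h
  refine ⟨η, hη, fun x y hx hxy => (h1 x y hx hxy).1, fun s hs => ?_, fun s hs => ?_⟩
  · simpa [hz] using (h1 0 s le_rfl hs).1
  · simpa [hz] using (h1 0 (-s) le_rfl (by linarith)).2

lemma MemGsqc.exists_nonneg_eq {G : ℝ → ℝ} (hG : MemGsqc G) {β : ℝ} (hβ : 0 ≤ β) :
    ∃ M ∈ Ici (0 : ℝ), G M = β := by
  obtain ⟨η, hη, -, h, -⟩ := hG.exists_rate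
  have h1 := h (β / η) (by positivity)
  rw [mul_div_cancel₀ _ hη.ne'] at h1
  obtain ⟨M, hM, hGM⟩ := intermediate_value_Icc (show 0 ≤ β / η by positivity)
    hG.continuous.continuousOn ⟨hG.2.1.le.trans hβ, h1⟩
  exact ⟨M, hM.1, hGM⟩

lemma MemGsqc.GplusInv_spec {G : ℝ → ℝ} (hG : MemGsqc G) {β : ℝ} (hβ : 0 ≤ β) :
    0 ≤ GplusInv G β ∧ G (GplusInv G β) = β :=
  ⟨Function.invFunOn_mem (hG.exists_nonneg_eq hβ), Function.invFunOn_eq (hG.exists_nonneg_eq hβ)⟩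

lemma MemGsqc.GminusInv_spec {G : ℝ → ℝ} (hG : MemGsqc G) {β : ℝ} (hβ : 0 ≤ β) :
    GminusInv G β ≤ 0 ∧ G (GminusInv G β) = β := by
  have : ∃ M ∈ Iic (0 : ℝ), G M = β := by
    obtain ⟨M, hM, h⟩ := hG.neg.exists_nonneg_eq hβ
    exact ⟨-M, mem_Iic.2 (neg_nonpos.2 (mem_Ici.1 hM)), h⟩
  exact ⟨Function.invFunOn_mem this, Function.invFunOn_eq this⟩

lemma MemGsqc.GplusInv_zero {G : ℝ → ℝ} (hG : MemGsqc G) : GplusInv G 0 = 0 := by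
  obtain ⟨η, hη, -, h, -⟩ := hG.exists_rate
  obtain ⟨h1, h2⟩ := hG.GplusInv_spec le_rfl
  have := h _ h1
  rw [h2] at this
  nlinarith

lemma MemGsqc.GminusInv_zero {G : ℝ → ℝ} (hG : MemGsqc G) : GminusInv G 0 = 0 := by
  obtain ⟨η, hη, -, -, h⟩ := hG.exists_rate
  obtain ⟨h1, h2⟩ := hG.GminusInv_spec le_rfl
  have := h _ h1
  rw [h2] at this
  nlinarith

lemma abs_sub_le_of_hasDerivAt {u p : ℝ → ℝ} {M : ℝ} (hu : ∀ x, HasDerivAt u (p x) x)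
    (hp : ∀ x, |p x| ≤ M) (x y : ℝ) : |u x - u y| ≤ M * |x - y| := by
  have := convex_univ.norm_image_sub_le_of_norm_hasDerivWithin_le (f := u) (f' := p) (C := M)
    (fun x _ => (hu x).hasDerivWithinAt) (fun x _ => hp x) (mem_univ y) (mem_univ x)
  simpa using this

lemma lipschitzWith_of_hasDerivAt {u p : ℝ → ℝ} {M : ℝ} (hu : ∀ x, HasDerivAt u (p x) x)
    (hp : ∀ x, |p x| ≤ M) : ∃ K : NNReal, LipschitzWith K u := by
  have hM : 0 ≤ M := (abs_nonneg _).trans (hp 0)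
  refine ⟨M.toNNReal, LipschitzWith.of_dist_le_mul fun x y => ?_⟩
  rw [Real.dist_eq, Real.dist_eq, Real.coe_toNNReal _ hM]
  exact abs_sub_le_of_hasDerivAt hu hp x y

section Deterministic

variable {a V G p u : ℝ → ℝ} {β κ : ℝ}

lemma IsProfile.mem_Splus (hG : MemGsqc G) (hβ : 0 ≤ β) (ha0 : ∀ x, 0 ≤ a x) (hac : Continuous a)
    (hp : IsProfile a (fun x => β * (1 - V x)) G (Icc 0 (GplusInv G β)) p)
    (hu : ∀ x, HasDerivAt u (p x) x) : u ∈ Splus a V G β β := by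
  have hM := (hG.GplusInv_spec hβ).1
  obtain ⟨L, hL0, hL⟩ := hG.exists_lipschitz (GplusInv G β)
  have habs : ∀ s ∈ Icc 0 (GplusInv G β), |s| ≤ GplusInv G β := fun s hs => by
    rw [abs_of_nonneg hs.1]
    exact hs.2
  refine ⟨lipschitzWith_of_hasDerivAt hu fun x => habs _ (hp.1 x),
    hp.isViscSol ha0 hac hL0 (fun x hx y hy => hL x y (habs x hx) (habs y hy)) hu,
    .of_forall fun x => ?_⟩
  rw [(hu x).deriv, sub_self, hG.GplusInv_zero]
  exact hp.1 x

lemma IsProfile.mem_Sminus (hG : MemGsqc G) (hβ : 0 ≤ β) (ha0 : ∀ x, 0 ≤ a x) (hac : Continuous a)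
    (hp : IsProfile a (fun x => β * (1 - V x)) G (Icc (GminusInv G β) 0) p)
    (hu : ∀ x, HasDerivAt u (p x) x) : u ∈ Sminus a V G β β := by
  have hM := (hG.GminusInv_spec hβ).1
  obtain ⟨L, hL0, hL⟩ := hG.exists_lipschitz (-GminusInv G β)
  have habs : ∀ s ∈ Icc (GminusInv G β) 0, |s| ≤ -GminusInv G β := fun s hs => by
    rw [abs_of_nonpos hs.2]
    exact neg_le_neg hs.1
  refine ⟨lipschitzWith_of_hasDerivAt hu fun x => habs _ (hp.1 x),
    hp.isViscSol ha0 hac hL0 (fun x hx y hy => hL x y (habs x hx) (habs y hy)) hu,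
    .of_forall fun x => ?_⟩
  rw [(hu x).deriv, sub_self, hG.GminusInv_zero]
  exact hp.1 x

lemma exists_profile_of_eq {M : ℝ} (hG : MemGsqc G) (hM : 0 ≤ M) (hGM : G M = β) (hβ : 0 ≤ β)
    (ha : ∀ x, a x ∈ Icc (0 : ℝ) 1) (hV : ∀ x, V x ∈ Icc (0 : ℝ) 1) (hκ : 0 < κ)
    (haκ : ∀ x y, |√(a x) - √(a y)| ≤ κ * |x - y|) (hVκ : ∀ x y, |V x - V y| ≤ κ * |x - y|) :
    ∃ p, IsProfile a (fun x => β * (1 - V x)) G (Icc 0 M) p := by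
  obtain ⟨η, hη, hrate, -, -⟩ := hG.exists_rate
  obtain ⟨L, hL0, hL⟩ := hG.exists_lipschitz M
  refine exists_profile (η := η) (L := L) (κ := κ) (K := β * κ) (fun x => (ha x).1)
    (fun x => (ha x).2) hκ haκ hη hL0 hM hG.continuous hG.2.1 (fun x y hx hxy hy =>
      ⟨hrate x y hx hxy, ?_⟩) (fun x y => ?_) (fun x => ?_) (fun x => ?_)
  · have := hL y x (by rwa [abs_of_nonneg (hx.trans hxy)]) (by
      rw [abs_of_nonneg hx]
      exact hxy.trans hy)
    rw [abs_of_nonneg (sub_nonneg.2 hxy)] at this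
    exact (le_abs_self _).trans this
  · rw [← mul_sub, abs_mul, abs_of_nonneg hβ, mul_assoc, abs_sub_comm x y,
      show 1 - V x - (1 - V y) = V y - V x by ring]
    exact mul_le_mul_of_nonneg_left (hVκ y x) hβ
  · exact mul_nonneg hβ (by linarith [(hV x).2])
  · rw [hGM]
    nlinarith [(hV x).1]

lemma exists_profile_plus (hG : MemGsqc G) (hβ : 0 ≤ β) (ha : ∀ x, a x ∈ Icc (0 : ℝ) 1)
    (hV : ∀ x, V x ∈ Icc (0 : ℝ) 1) (hκ : 0 < κ)
    (haκ : ∀ x y, |√(a x) - √(a y)| ≤ κ * |x - y|) (hVκ : ∀ x y, |V x - V y| ≤ κ * |x - y|) :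
    ∃ p, IsProfile a (fun x => β * (1 - V x)) G (Icc 0 (GplusInv G β)) p :=
  exists_profile_of_eq hG (hG.GplusInv_spec hβ).1 (hG.GplusInv_spec hβ).2 hβ ha hV hκ haκ hVκ

lemma exists_profile_minus (hG : MemGsqc G) (hβ : 0 ≤ β) (ha : ∀ x, a x ∈ Icc (0 : ℝ) 1)
    (hV : ∀ x, V x ∈ Icc (0 : ℝ) 1) (hκ : 0 < κ)
    (haκ : ∀ x y, |√(a x) - √(a y)| ≤ κ * |x - y|) (hVκ : ∀ x y, |V x - V y| ≤ κ * |x - y|) :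
    ∃ p, IsProfile a (fun x => β * (1 - V x)) G (Icc (GminusInv G β) 0) p := by
  have habs : ∀ x y : ℝ, |-x - -y| = |x - y| := fun x y => by
    rw [abs_sub_comm]
    congr 1
    ring
  obtain ⟨p, hp⟩ := exists_profile_of_eq (a := fun x => a (-x)) (V := fun x => V (-x))
    (M := -GminusInv G β) hG.neg (neg_nonneg.2 (hG.GminusInv_spec hβ).1)
    (by simpa using (hG.GminusInv_spec hβ).2) hβ (fun x => ha _) (fun x => hV _) hκ
    (fun x y => habs x y ▸ haκ (-x) (-y)) (fun x y => habs x y ▸ hVκ (-x) (-y))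
  exact ⟨_, IsProfile.reflect (a := a) (g := fun x => β * (1 - V x)) hp
    fun s hs => ⟨by linarith [hs.2], by linarith [hs.1]⟩⟩

end Deterministic

/-- The profiles in a stationary environment generate a cocycle. -/
lemma exists_profile_family {Ω : Type*} {τ : ℝ → Ω → Ω} {a V U : ℝ → Ω → ℝ} {G : ℝ → ℝ} {β : ℝ}
    {I : Set ℝ} (ha : ∀ x y ω, a (x + y) ω = a x (τ y ω))
    (hV : ∀ x y ω, V (x + y) ω = V x (τ y ω))
    (hex : ∀ ω, ∃ p, IsProfile (fun x => a x ω) (fun x => β * (1 - V x ω)) G I p)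
    (huniq : ∀ ω p u, IsProfile (fun x => a x ω) (fun x => β * (1 - V x ω)) G I p →
      (∀ x, HasDerivAt u (p x) x) → u 0 = 0 → u = fun x => U x ω) :
    ∃ p : ℝ → Ω → ℝ,
      (∀ ω, IsProfile (fun x => a x ω) (fun x => β * (1 - V x ω)) G I fun x => p x ω) ∧
      (∀ ω x, HasDerivAt (fun x => U x ω) (p x ω) x) ∧
      ∀ x y ω, U (x + y) ω = U y ω + U x (τ y ω) := by
  choose p hp using hex
  have hder : ∀ ω x, HasDerivAt (fun x => U x ω) (p ω x) x := by
    intro ω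
    have h1 := (hp ω).continuous.hasDerivAt_primitive 0
    rw [← huniq ω (p ω) _ (hp ω) h1 (by simp)]
    exact h1
  refine ⟨fun x ω => p ω x, hp, hder, fun x y ω => ?_⟩
  have h1 := (hp ω).comp_add_const y
  simp only [ha, hV] at h1
  have h2 := huniq (τ y ω) _ (fun x => U (x + y) ω - U y ω) h1
    (fun x => ((hder ω (x + y)).comp_add_const x y).sub_const _) (by simp)
  linarith [congrFun h2 x]

lemma abs_sub_le_of_lipschitzWith {f : ℝ → ℝ} {κ : ℝ} (hκ : 0 < κ)
    (h : LipschitzWith (Real.toNNReal κ) f) (x y : ℝ) : |f x - f y| ≤ κ * |x - y| := by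
  have := h.dist_le_mul x y
  rwa [Real.dist_eq, Real.dist_eq, Real.coe_toNNReal _ hκ.le] at this

/-- Linear bounds, in both directions, on the two sides of a Lipschitz cocycle with mean slope
`m`. -/
lemma ae_linear_bounds {Ω : Type*} [MeasurableSpace Ω] {P : Measure Ω}
    [IsProbabilityMeasure P] {τ : ℝ → Ω → Ω} (hτ_zero : ∀ ω, τ 0 ω = ω)
    (hτ_add : ∀ x y : ℝ, ∀ ω, τ (x + y) ω = τ x (τ y ω))
    (hτ_mp : ∀ x : ℝ, MeasurePreserving (τ x) P P)
    (hτ_erg : ∀ g : Ω → ℝ, Measurable g →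
      (∀ x : ℝ, ∀ᵐ ω ∂P, g (τ x ω) = g ω) → ∃ c : ℝ, ∀ᵐ ω ∂P, g ω = c)
    {u p : ℝ → Ω → ℝ} (hu : ∀ x, Measurable (u x))
    (hcoc : ∀ x y ω, u (x + y) ω = u y ω + u x (τ y ω)) {M : ℝ}
    (hp : ∀ ω x, HasDerivAt (fun x => u x ω) (p x ω) x) (hpM : ∀ ω x, |p x ω| ≤ M)
    {m c : ℝ} (hm : m = ∫ ω, deriv (fun x => u x ω) 0 ∂P) :
    (m < c → ∀ᵐ ω ∂P, (∃ C, ∀ x, 0 ≤ x → u x ω ≤ c * x + C) ∧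
      ∃ C, ∀ x, 0 ≤ x → -u (-x) ω ≤ c * x + C) ∧
    (c < m → ∀ᵐ ω ∂P, (∃ C, ∀ x, 0 ≤ x → -u x ω ≤ -c * x + C) ∧
      ∃ C, ∀ x, 0 ≤ x → u (-x) ω ≤ -c * x + C) := by
  have hu0 : ∀ ω, u 0 ω = 0 := fun ω => by
    have := hcoc 0 0 ω
    rw [hτ_zero, add_zero] at this
    linarith
  have hlip : ∀ ω x y, |u x ω - u y ω| ≤ M * |x - y| := fun ω =>
    abs_sub_le_of_hasDerivAt (hp ω) (hpM ω)
  obtain ⟨h1, h2⟩ := integral_eq_integral_of_hasDerivAt hτ_mp hu hu0 hcoc hlip fun ω => hp ω 0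
  simp only [fun ω => (hp ω 0).deriv] at hm
  rw [h1] at hm
  have habs : ∀ x y : ℝ, |-x - -y| = |x - y| := fun x y => by
    rw [abs_sub_comm]
    congr 1
    ring
  have hneg_add : ∀ x y : ℝ, ∀ ω, τ (-(x + y)) ω = τ (-x) (τ (-y) ω) := fun x y ω => by
    rw [neg_add, hτ_add]
  have hneg_erg : ∀ g : Ω → ℝ, Measurable g →
      (∀ x : ℝ, ∀ᵐ ω ∂P, g (τ (-x) ω) = g ω) → ∃ c : ℝ, ∀ᵐ ω ∂P, g ω = c :=
    fun g hg h => hτ_erg g hg fun x => by simpa using h (-x)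
  have hcoc' : ∀ x y ω, u (-(x + y)) ω = u (-y) ω + u (-x) (τ (-y) ω) := fun x y ω => by
    rw [neg_add, hcoc]
  constructor <;> intro hc
  · have e1 := ae_exists_le_of_integral_lt hτ_zero hτ_add hτ_mp hτ_erg hu hcoc hlip (c := c)
      (by rwa [← hm])
    have e2 := ae_exists_le_of_integral_lt (τ := fun x => τ (-x)) (u := fun x ω => -u (-x) ω)
      (M := M) (c := c) (by simpa using hτ_zero) hneg_add (fun x => hτ_mp _) hneg_erg
      (fun x => (hu _).neg) (fun x y ω => by rw [hcoc']; ring)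
      (fun ω x y => by
        rw [← habs x y, ← abs_neg]
        convert hlip ω (-x) (-y) using 2
        ring)
      (by rw [integral_neg, h2, ← hm]; simpa using hc)
    filter_upwards [e1, e2] with ω h h' using ⟨h, h'⟩
  · have e1 := ae_exists_le_of_integral_lt (u := fun x ω => -u x ω) (M := M) (c := -c)
      hτ_zero hτ_add hτ_mp hτ_erg (fun x => (hu _).neg) (fun x y ω => by rw [hcoc]; ring)
      (fun ω x y => by
        rw [← abs_neg]
        convert hlip ω x y using 2
        ring)
      (by rw [integral_neg, ← hm]; linarith)
    have e2 := ae_exists_le_of_integral_lt (τ := fun x => τ (-x)) (u := fun x ω => u (-x) ω)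
      (M := M) (c := -c) (by simpa using hτ_zero) hneg_add (fun x => hτ_mp _) hneg_erg
      (fun x => hu _) hcoc' (fun ω x y => by rw [← habs x y]; exact hlip ω (-x) (-y))
      (by rw [h2, ← hm]; linarith)
    filter_upwards [e1, e2] with ω h h' using ⟨h, h'⟩

theorem flat_part_of_effective_hamiltonian
    {Ω : Type*} [MeasurableSpace Ω] (P : Measure Ω) [IsProbabilityMeasure P]
    (τ : ℝ → Ω → Ω)
    (hτ_meas : Measurable (fun p : ℝ × Ω => τ p.1 p.2))
    (hτ_zero : ∀ ω, τ 0 ω = ω)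
    (hτ_add : ∀ x y : ℝ, ∀ ω, τ (x + y) ω = τ x (τ y ω))
    (hτ_mp : ∀ x : ℝ, MeasurePreserving (τ x) P P)
    (hτ_erg : ∀ g : Ω → ℝ, Measurable g →
      (∀ x : ℝ, ∀ᵐ ω ∂P, g (τ x ω) = g ω) → ∃ c : ℝ, ∀ᵐ ω ∂P, g ω = c)
    (a V : ℝ → Ω → ℝ) (κ : ℝ) (hκ : 0 < κ)
    (ha_meas : Measurable (fun p : ℝ × Ω => a p.1 p.2))
    (hV_meas : Measurable (fun p : ℝ × Ω => V p.1 p.2))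
    (ha_range : ∀ x ω, a x ω ∈ Set.Icc (0 : ℝ) 1)
    (hV_range : ∀ x ω, V x ω ∈ Set.Icc (0 : ℝ) 1)
    (ha_lip : ∀ ω, LipschitzWith (Real.toNNReal κ) (fun x => Real.sqrt (a x ω)))
    (hV_lip : ∀ ω, LipschitzWith (Real.toNNReal κ) (fun x => V x ω))
    (ha_stat : ∀ x ω, a x ω = a 0 (τ x ω))
    (hV_stat : ∀ x ω, V x ω = V 0 (τ x ω))
    -- the scaled hill condition (S)
    (hS : ∀ h ∈ Set.Ioo (0 : ℝ) 1, ∀ y : ℝ, 0 < y →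
      ∃ Ωhy : Set Ω, MeasurableSet Ωhy ∧ P Ωhy = 1 ∧
        ∀ ω ∈ Ωhy, ∃ ℓ₁ ℓ₂ δ : ℝ, ℓ₁ < ℓ₂ ∧ 0 < δ ∧
          (∫ x in ℓ₁..ℓ₂, 1 / max (a x ω) δ) = y ∧
          ∀ x ∈ Set.Icc ℓ₁ ℓ₂, h ≤ V x ω)
    (β : ℝ) (hβ : 0 ≤ β)
    (G : ℝ → ℝ) (hG : MemGsqc G)
    (up um : ℝ → Ω → ℝ)
    (hup_meas : Measurable (fun p : ℝ × Ω => up p.1 p.2))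
    (hum_meas : Measurable (fun p : ℝ × Ω => um p.1 p.2))
    (hup : ∀ ω, (fun x => up x ω) ∈ Splus (fun x => a x ω) (fun x => V x ω) G β β ∧
      up 0 ω = 0 ∧
      ∀ v ∈ Splus (fun x => a x ω) (fun x => V x ω) G β β, v 0 = 0 → v = fun x => up x ω)
    (hum : ∀ ω, (fun x => um x ω) ∈ Sminus (fun x => a x ω) (fun x => V x ω) G β β ∧
      um 0 ω = 0 ∧
      ∀ v ∈ Sminus (fun x => a x ω) (fun x => V x ω) G β β, v 0 = 0 → v = fun x => um x ω)
    (θm θp : ℝ)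
    (hθm : θm = ∫ ω, deriv (fun x => um x ω) 0 ∂P)
    (hθp : θp = ∫ ω, deriv (fun x => up x ω) 0 ∂P)
    (θ : ℝ) (hθ : θ ∈ Set.Ioo θm θp) :
    ∃ Ωhat : Set Ω, MeasurableSet Ωhat ∧ P Ωhat = 1 ∧
      ∀ ω ∈ Ωhat, ∀ uθ : ℝ → ℝ → ℝ,
        (∃ K : NNReal, LipschitzOnWith K (fun p : ℝ × ℝ => uθ p.1 p.2)
          (Set.Ici 0 ×ˢ Set.univ)) →
        IsParabolicViscSol (fun x => a x ω) (fun x => V x ω) G β uθ →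
        (∀ x : ℝ, uθ 0 x = θ * x) →
        Filter.Tendsto (fun t => uθ t 0 / t) Filter.atTop (nhds β) := by
  have ha_shift : ∀ x y ω, a (x + y) ω = a x (τ y ω) := fun x y ω => by
    rw [ha_stat, hτ_add, ← ha_stat]
  have hV_shift : ∀ x y ω, V (x + y) ω = V x (τ y ω) := fun x y ω => by
    rw [hV_stat, hτ_add, ← hV_stat]
  have haκ : ∀ ω x y, |√(a x ω) - √(a y ω)| ≤ κ * |x - y| := fun ω =>
    abs_sub_le_of_lipschitzWith hκ (ha_lip ω)
  have hVκ : ∀ ω x y, |V x ω - V y ω| ≤ κ * |x - y| := fun ω =>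
    abs_sub_le_of_lipschitzWith hκ (hV_lip ω)
  have ha0 : ∀ ω x, 0 ≤ a x ω := fun ω x => (ha_range x ω).1
  have hac : ∀ ω, Continuous fun x => a x ω := fun ω => by
    refine ((ha_lip ω).continuous.pow 2).congr fun x => ?_
    exact Real.sq_sqrt (ha0 ω x)
  obtain ⟨hMp0, -⟩ := hG.GplusInv_spec hβ
  obtain ⟨hMm0, -⟩ := hG.GminusInv_spec hβ
  obtain ⟨η, hη, -, hG1, hG2⟩ := hG.exists_rate
  obtain ⟨pp, hpp, hpp_der, hpp_coc⟩ := exists_profile_family (U := up)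
    (I := Icc 0 (GplusInv G β)) ha_shift hV_shift
    (fun ω => exists_profile_plus hG hβ (fun x => ha_range x ω) (fun x => hV_range x ω) hκ
      (haκ ω) (hVκ ω))
    (fun ω p u hp hu h0 => (hup ω).2.2 u (hp.mem_Splus hG hβ (ha0 ω) (hac ω) hu) h0)
  obtain ⟨pm, hpm, hpm_der, hpm_coc⟩ := exists_profile_family (U := um)
    (I := Icc (GminusInv G β) 0) ha_shift hV_shift
    (fun ω => exists_profile_minus hG hβ (fun x => ha_range x ω) (fun x => hV_range x ω) hκ
      (haκ ω) (hVκ ω))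
    (fun ω p u hp hu h0 => (hum ω).2.2 u (hp.mem_Sminus hG hβ (ha0 ω) (hac ω) hu) h0)
  have hup_bound := (ae_linear_bounds hτ_zero hτ_add hτ_mp hτ_erg (u := up)
    (fun x => hup_meas.comp measurable_prodMk_left) hpp_coc hpp_der (M := GplusInv G β)
    (fun ω x => by
      rw [abs_of_nonneg ((hpp ω).1 x).1]
      exact ((hpp ω).1 x).2) hθp (c := (θ + θp) / 2)).2 (by linarith [hθ.2])
  have hum_bound := (ae_linear_bounds hτ_zero hτ_add hτ_mp hτ_erg (u := um)
    (fun x => hum_meas.comp measurable_prodMk_left) hpm_coc hpm_der (M := -GminusInv G β)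
    (fun ω x => by
      rw [abs_of_nonpos ((hpm ω).1 x).2]
      exact neg_le_neg ((hpm ω).1 x).1) hθm (c := (θ + θm) / 2)).1 (by linarith [hθ.1])
  have hhill : ∀ᵐ ω ∂P, ∀ n : ℕ, ∃ ℓ₁ ℓ₂ d : ℝ, ℓ₁ < ℓ₂ ∧ 0 < d ∧
      (∫ x in ℓ₁..ℓ₂, 1 / max (a x ω) d) = n + 1 ∧
      ∀ x ∈ Icc ℓ₁ ℓ₂, 1 - 1 / ((n : ℝ) + 2) ≤ V x ω := by
    rw [ae_all_iff]
    intro n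
    have hn : (0 : ℝ) < n + 2 := by positivity
    obtain ⟨A, hA, hPA, h⟩ := hS (1 - 1 / ((n : ℝ) + 2))
      ⟨by rw [sub_pos, div_lt_one hn]; linarith [n.cast_nonneg (α := ℝ)],
        sub_lt_self _ (one_div_pos.2 hn)⟩ (n + 1) (by positivity)
    filter_upwards [(mem_ae_iff_prob_eq_one hA).2 hPA] with ω hω using h ω hω
  obtain ⟨A, hA, hAm, hAω⟩ := (hup_bound.and (hum_bound.and hhill)).exists_measurable_mem
  refine ⟨A, hAm, (mem_ae_iff_prob_eq_one hAm).1 hA, fun ω hω w ⟨K, hK⟩ hw hw0 => ?_⟩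
  obtain ⟨⟨⟨C₁, h₁⟩, C₂, h₂⟩, ⟨⟨C₃, h₃⟩, C₄, h₄⟩, hhillω⟩ := hAω ω hω
  refine hw.tendsto_div (K := K) (M₂ := -GminusInv G β) hw0 (fun t ht x => ?_) (ha0 ω) (hac ω) hη
    hG.continuous hG.2.1 hG1 hG2 hβ hMp0 (by linarith) (hpp ω) (by rw [neg_neg]; exact hpm ω)
    hhillω (hpp_der ω) (hpm_der ω) (by linarith [hθ.2]) (by linarith [hθ.1]) h₁ h₂ h₃ h₄
  have := hK.dist_le_mul (t, x) ⟨ht, mem_univ _⟩ (0, x) ⟨self_mem_Ici, mem_univ _⟩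
  rw [Prod.dist_eq, dist_self, max_eq_left dist_nonneg, Real.dist_eq, Real.dist_eq, sub_zero,
    abs_of_nonneg ht] at this
  simpa only [hw0] using this
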